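/- arXiv:1505.05209 — 3 statements merged into one kernel-verified Lean document; each statement's English description precedes it below -/
import Mathlib

section
/- Let R = k[x_1,…,x_d] be a standard graded polynomial ring over a field with maximal homogeneous ideal 𝔪, let C_• : ⋯ → C_2 → C_1 → C_0 → 0 be a graded complex of finitely generated graded R-modules, and M = H_0(C_•). Assume dim H_j(C_•) ≤ j whenever 1 ≤ j ≤ d − 1 and min{d, j + 2} ≤ depth C_j whenever 0 ≤ j ≤ d − 1. Then b_0(H^0_𝔪(M)) ≤ b_0(C_{d−1}) − d + 1. -/
/-!
Statement 7 (Corollary `SJD-cor2` of the paper).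

`R = k[x₁,…,x_d]` is a standard graded polynomial ring over a field (encoded via the
grading `𝒜` with `𝒜 0` a field and variables `x i ∈ 𝒜 1` inducing a bijection
`k[X₁,…,X_d] ≃ R`), with maximal homogeneous ideal `𝔪`; `C_•` is a graded complex of
finitely generated graded `R`-modules with `M = H₀(C_•)`; `dim H_j(C_•) ≤ j` for
`1 ≤ j ≤ d - 1`, and `min{d, j+2} ≤ depth C_j` for `0 ≤ j ≤ d - 1`.

Conclusion: `b₀(H⁰_𝔪(M)) ≤ b₀(C_{d-1}) - d + 1`, stated as: for every `β` with
`b₀(C_{d-1}) ≤ β` (i.e. `C_{d-1}` is generated in degrees `≤ β`), the torsion submodule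
`H⁰_𝔪(M)` is generated in degrees `≤ β - d + 1`.
-/

noncomputable section
namespace Paper

variable {R : Type} [CommRing R]

def maxHomIdeal (𝒜 : ℤ → AddSubgroup R) [GradedRing 𝒜] : Ideal R :=
  Ideal.span ({ r : R | ∃ h : r ∈ 𝒜 0, ¬ IsUnit (⟨r, h⟩ : 𝒜 0) } ∪
    ⋃ (i : ℤ) (_ : i ≠ 0), (𝒜 i : Set R))

def GenDegLE {M : Type} [AddCommGroup M] [Module R M] (ℳ : ℤ → AddSubgroup M) (b : ℤ) : Prop :=
  Submodule.span R (⋃ (j : ℤ) (_ : j ≤ b), (ℳ j : Set M)) = ⊤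

/-- The submodule `T` of the graded module `M` is generated in degrees at most `b`. -/
def SubGenDegLE {M : Type} [AddCommGroup M] [Module R M] (ℳ : ℤ → AddSubgroup M)
    (T : Submodule R M) (b : ℤ) : Prop :=
  T ≤ Submodule.span R (⋃ (j : ℤ) (_ : j ≤ b), ((T : Set M) ∩ (ℳ j : Set M)))

def depthGE (I : Ideal R) (N : Type) [AddCommGroup N] [Module R N] (k : ℕ) : Prop :=
  Subsingleton N ∨ ∃ rs : List R, rs.length = k ∧ (∀ r ∈ rs, r ∈ I) ∧
    RingTheory.Sequence.IsRegular N rs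

def modDimLE (N : Type) [AddCommGroup N] [Module R N] (b : ℕ) : Prop :=
  ringKrullDim (R ⧸ Module.annihilator R N) ≤ (b : WithBot (WithTop ℕ))

/-- The `0`-th local cohomology `H⁰_I(M)`: the `I`-power-torsion submodule of `M`. -/
def torsionSubmodule (I : Ideal R) (M : Type) [AddCommGroup M] [Module R M] :
    Submodule R M where
  carrier := { x | ∃ t : ℕ, ∀ r ∈ I ^ t, r • x = 0 }
  zero_mem' := ⟨0, fun r _ => smul_zero r⟩
  add_mem' := by
    rintro a b ⟨t, ht⟩ ⟨m, hm⟩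
    refine ⟨t + m, fun r hr => ?_⟩
    have h1 : r ∈ I ^ t := Ideal.pow_le_pow_right (Nat.le_add_right t m) hr
    have h2 : r ∈ I ^ m := Ideal.pow_le_pow_right (Nat.le_add_left m t) hr
    rw [smul_add, ht r h1, hm r h2, add_zero]
  smul_mem' := by
    rintro c x ⟨t, ht⟩
    exact ⟨t, fun r hr => by rw [smul_comm, ht r hr, smul_zero]⟩

abbrev Hmod (C : ℕ → Type) [∀ j, AddCommGroup (C j)] [∀ j, Module R (C j)]
    (dl : ∀ j, C (j + 1) →ₗ[R] C j) (j : ℕ) : Type :=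
  ↥(LinearMap.ker (dl j)) ⧸
    (Submodule.comap (LinearMap.ker (dl j)).subtype (LinearMap.range (dl (j + 1))))

/-! ### The Koszul cochain complexes on powers of the variables -/

section Koszul

variable {d : ℕ} {N N' : Type} [AddCommGroup N] [Module R N] [AddCommGroup N'] [Module R N']

/-- The sign of `i` relative to the finite set `S`. -/
def koszulSign (R : Type) [CommRing R] (i : Fin d) (S : Finset (Fin d)) : R :=
  (-1) ^ (S.filter (· < i)).card

lemma koszulSign_mul_self (i : Fin d) (S : Finset (Fin d)) :
    koszulSign R i S * koszulSign R i S = 1 := by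
  rw [koszulSign, ← mul_pow]; simp

lemma koszulSign_insert {i k : Fin d} {S : Finset (Fin d)} (hk : k ∉ S) :
    koszulSign R i (insert k S) = if k < i then -koszulSign R i S else koszulSign R i S := by
  unfold koszulSign
  rw [Finset.filter_insert]
  split_ifs with h
  · rw [Finset.card_insert_of_notMem (by simp [hk]), pow_succ]; ring
  · rfl

lemma koszulSign_insert_self {i : Fin d} {S : Finset (Fin d)} (hi : i ∉ S) :
    koszulSign R i (insert i S) = koszulSign R i S := by
  rw [koszulSign_insert hi, if_neg (lt_irrefl i)]

/-- The differential of the Koszul cochain complex of `x₁ⁿ, …, x_dⁿ` with values in `N`. -/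
def koszulD (x : Fin d → R) (n : ℕ) : (Finset (Fin d) → N) →ₗ[R] (Finset (Fin d) → N) where
  toFun w S := ∑ i ∈ S, (koszulSign R i S * x i ^ n) • w (S.erase i)
  map_add' v w := by ext S; simp [Finset.sum_add_distrib]
  map_smul' r w := by
    ext S
    simp only [Pi.smul_apply, RingHom.id_apply, Finset.smul_sum]
    exact Finset.sum_congr rfl fun i _ => smul_comm _ _ _

lemma koszulD_apply (x : Fin d → R) (n : ℕ) (w : Finset (Fin d) → N) (S : Finset (Fin d)) :
    koszulD x n w S = ∑ i ∈ S, (koszulSign R i S * x i ^ n) • w (S.erase i) := rfl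

/-- The transition map from the Koszul complex on `xⁿ` to the one on `xⁿ⁺ᵐ`. -/
def koszulT (x : Fin d → R) (m : ℕ) : (Finset (Fin d) → N) →ₗ[R] (Finset (Fin d) → N) where
  toFun w S := (∏ i ∈ S, x i ^ m) • w S
  map_add' v w := by ext S; simp
  map_smul' r w := by ext S; exact smul_comm _ _ _

lemma koszulT_apply (x : Fin d → R) (m : ℕ) (w : Finset (Fin d) → N) (S : Finset (Fin d)) :
    koszulT x m w S = (∏ i ∈ S, x i ^ m) • w S := rfl

/-- Apply a linear map to all coefficients of a cochain. -/
def koszulMap (d : ℕ) (f : N →ₗ[R] N') : (Finset (Fin d) → N) →ₗ[R] (Finset (Fin d) → N') :=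
  f.compLeft _

lemma koszulMap_apply (f : N →ₗ[R] N') (w : Finset (Fin d) → N) (S : Finset (Fin d)) :
    koszulMap d f w S = f (w S) := rfl

/-- The cochain `w` is concentrated in cohomological degree `p`. -/
def KoszulDeg (p : ℤ) (w : Finset (Fin d) → N) : Prop := ∀ S, (S.card : ℤ) ≠ p → w S = 0

lemma KoszulDeg.add {p : ℤ} {v w : Finset (Fin d) → N} (hv : KoszulDeg p v)
    (hw : KoszulDeg p w) : KoszulDeg p (v + w) := fun S h => by simp [hv S h, hw S h]

lemma KoszulDeg.sub {p : ℤ} {v w : Finset (Fin d) → N} (hv : KoszulDeg p v)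
    (hw : KoszulDeg p w) : KoszulDeg p (v - w) := fun S h => by simp [hv S h, hw S h]

lemma KoszulDeg.smul {p : ℤ} {w : Finset (Fin d) → N} (r : R)
    (hw : KoszulDeg p w) : KoszulDeg p (r • w) := fun S h => by simp [hw S h]

lemma KoszulDeg.trans {p : ℤ} {w : Finset (Fin d) → N} (x : Fin d → R) (m : ℕ)
    (hw : KoszulDeg p w) : KoszulDeg p (koszulT x m w) :=
  fun S h => by simp [koszulT_apply, hw S h]

lemma KoszulDeg.map {p : ℤ} {w : Finset (Fin d) → N} (f : N →ₗ[R] N')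
    (hw : KoszulDeg p w) : KoszulDeg p (koszulMap d f w) :=
  fun S h => by simp [koszulMap_apply, hw S h]

lemma KoszulDeg.diff {p : ℤ} {w : Finset (Fin d) → N} (x : Fin d → R) (n : ℕ)
    (hw : KoszulDeg p w) : KoszulDeg (p + 1) (koszulD x n w) := fun S h => by
  refine Finset.sum_eq_zero fun i hi => ?_
  rw [hw, smul_zero]
  have := Finset.card_erase_add_one hi
  omega

lemma KoszulDeg.eq_zero_of_neg {p : ℤ} (hp : p < 0) {w : Finset (Fin d) → N}
    (hw : KoszulDeg p w) : w = 0 := funext fun S => hw S (by omega)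

lemma KoszulDeg.eq_zero_of_lt {p : ℤ} (hp : d < p) {w : Finset (Fin d) → N}
    (hw : KoszulDeg p w) : w = 0 := funext fun S => hw S (by
  have := Finset.card_le_univ S
  rw [Fintype.card_fin] at this
  omega)

lemma KoszulDeg.single (S : Finset (Fin d)) (u : N) :
    KoszulDeg (S.card : ℤ) (Pi.single S u : Finset (Fin d) → N) := fun T h => by
  rw [Pi.single_eq_of_ne]
  rintro rfl
  exact h rfl

lemma koszulD_koszulD (x : Fin d → R) (n : ℕ) (w : Finset (Fin d) → N) :
    koszulD x n (koszulD x n w) = 0 := by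
  ext S
  simp only [koszulD_apply, Finset.smul_sum, Pi.zero_apply, smul_smul]
  rw [Finset.sum_sigma' S (fun i => S.erase i)
    (fun i j => (koszulSign R i S * x i ^ n * (koszulSign R j (S.erase i) * x j ^ n)) •
      w ((S.erase i).erase j))]
  refine Finset.sum_involution (fun a _ => ⟨a.2, a.1⟩) ?_ ?_ ?_ ?_
  · rintro ⟨i, j⟩ h
    simp only [Finset.mem_sigma, Finset.mem_erase] at h
    obtain ⟨hi, hji, hj⟩ := h
    obtain ⟨T, hiT, rfl⟩ : ∃ T, i ∉ T ∧ insert i T = S :=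
      ⟨S.erase i, by simp, Finset.insert_erase hi⟩
    have hjT : j ∈ T := by simpa [hji] using hj
    obtain ⟨U, hjU, rfl⟩ : ∃ U, j ∉ U ∧ insert j U = T :=
      ⟨T.erase j, by simp, Finset.insert_erase hjT⟩
    have hiU : i ∉ U := fun h => hiT (by simp [h])
    have hjiU : j ∉ insert i U := by simp [hji, hjU]
    have e1 : (insert i (insert j U)).erase i = insert j U := Finset.erase_insert hiT
    have e2 : (insert i (insert j U)).erase j = insert i U := by
      rw [Finset.insert_comm, Finset.erase_insert hjiU]
    simp only [e1, e2, Finset.erase_insert hjU, Finset.erase_insert hiU, ← add_smul]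
    convert zero_smul R (w U)
    rw [koszulSign_insert_self hiT, Finset.insert_comm i j U, koszulSign_insert_self hjiU,
      koszulSign_insert_self hjU, koszulSign_insert_self hiU, koszulSign_insert hjU,
      koszulSign_insert hiU]
    rcases lt_or_gt_of_ne hji with h | h
    · rw [if_pos h, if_neg h.not_gt]; ring
    · rw [if_pos h, if_neg h.not_gt]; ring
  · rintro ⟨i, j⟩ h _ h2
    simp only [Finset.mem_sigma, Finset.mem_erase] at h
    simp only [Sigma.mk.injEq, heq_eq_eq] at h2
    exact h.2.1 h2.1
  · rintro ⟨i, j⟩ h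
    simp only [Finset.mem_sigma, Finset.mem_erase] at h ⊢
    exact ⟨h.2.2, h.2.1.symm, h.1⟩
  · rintro ⟨i, j⟩ h
    rfl

lemma koszulD_koszulT (x : Fin d → R) (n m : ℕ) (w : Finset (Fin d) → N) :
    koszulD x (n + m) (koszulT x m w) = koszulT x m (koszulD x n w) := by
  ext S
  simp only [koszulD_apply, koszulT_apply, Finset.smul_sum, smul_smul]
  refine Finset.sum_congr rfl fun i hi => ?_
  rw [← Finset.mul_prod_erase S _ hi, pow_add]
  congr 1
  ring

lemma koszulT_koszulT (x : Fin d → R) (n m : ℕ) (w : Finset (Fin d) → N) :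
    koszulT x m (koszulT x n w) = koszulT x (n + m) w := by
  ext S
  simp only [koszulT_apply, smul_smul, ← Finset.prod_mul_distrib, pow_add, mul_comm]

lemma koszulT_zero (x : Fin d → R) (w : Finset (Fin d) → N) : koszulT x 0 w = w := by
  ext S
  simp [koszulT_apply]

lemma koszulT_of_deg_zero (x : Fin d → R) (m : ℕ) {w : Finset (Fin d) → N}
    (hw : KoszulDeg 0 w) : koszulT x m w = w := by
  ext S
  by_cases hS : S = ∅
  · simp [hS, koszulT_apply]
  · have : w S = 0 := hw S (by simpa using hS)
    simp [koszulT_apply, this]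

lemma koszulMap_koszulD (f : N →ₗ[R] N') (x : Fin d → R) (n : ℕ) (w : Finset (Fin d) → N) :
    koszulMap d f (koszulD x n w) = koszulD x n (koszulMap d f w) := by
  ext S
  simp [koszulMap_apply, koszulD_apply]

lemma koszulMap_koszulT (f : N →ₗ[R] N') (x : Fin d → R) (m : ℕ) (w : Finset (Fin d) → N) :
    koszulMap d f (koszulT x m w) = koszulT x m (koszulMap d f w) := by
  ext S
  simp [koszulMap_apply, koszulT_apply]

/-- Lift a cochain with values in the image of `f`, preserving the cohomological degree. -/
lemma exists_koszulMap_eq (f : N →ₗ[R] N') {p : ℤ} {w : Finset (Fin d) → N'}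
    (hw : KoszulDeg p w) (h : ∀ S, w S ∈ LinearMap.range f) :
    ∃ v, KoszulDeg p v ∧ koszulMap d f v = w := by
  choose g hg using h
  refine ⟨fun S => if (S.card : ℤ) = p then g S else 0, fun S hS => if_neg hS, ?_⟩
  ext S
  by_cases hS : (S.card : ℤ) = p
  · simp [koszulMap_apply, hS, hg]
  · simp [koszulMap_apply, hS, hw S hS]

/-- Contraction by the `k`-th basis vector, the contracting homotopy for `x_kⁿ`. -/
def koszulContract (R : Type) [CommRing R] {N : Type} [AddCommGroup N] [Module R N] (k : Fin d)
    (w : Finset (Fin d) → N) (S : Finset (Fin d)) : N :=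
  if k ∈ S then 0 else koszulSign R k S • w (insert k S)

lemma KoszulDeg.contract {p : ℤ} {w : Finset (Fin d) → N} (k : Fin d)
    (hw : KoszulDeg p w) : KoszulDeg (p - 1) (koszulContract R k w) := fun S h => by
  unfold koszulContract
  split_ifs with hk
  · rfl
  · rw [hw, smul_zero]
    rw [Finset.card_insert_of_notMem hk]
    push_cast
    omega

lemma koszulD_contract_add (x : Fin d → R) (n : ℕ) (k : Fin d) (w : Finset (Fin d) → N) :
    koszulD x n (koszulContract R k w) + koszulContract R k (koszulD x n w) = x k ^ n • w := by
  ext S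
  by_cases hk : k ∈ S
  · obtain ⟨T, hkT, rfl⟩ : ∃ T, k ∉ T ∧ insert k T = S :=
      ⟨S.erase k, by simp, Finset.insert_erase hk⟩
    rw [Pi.add_apply, koszulD_apply, Finset.sum_eq_single k]
    · rw [Finset.erase_insert hkT]
      simp only [koszulContract, hkT, hk, if_true, if_false, smul_smul, add_zero, Pi.smul_apply]
      rw [koszulSign_insert_self hkT, mul_right_comm, koszulSign_mul_self, one_mul]
    · intro i hi hik
      rw [koszulContract, if_pos (by simp [Ne.symm hik]), smul_zero]
    · intro h
      exact absurd hk h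
  · simp only [Pi.add_apply, koszulContract, hk, if_false, koszulD_apply, Finset.sum_insert hk,
      Finset.erase_insert hk, smul_add, Finset.smul_sum, smul_smul, Pi.smul_apply]
    rw [koszulSign_insert_self hk, ← mul_assoc, koszulSign_mul_self, one_mul, add_left_comm,
      ← Finset.sum_add_distrib, Finset.sum_eq_zero, add_zero]
    intro i hi
    obtain ⟨T, hiT, rfl⟩ : ∃ T, i ∉ T ∧ insert i T = S :=
      ⟨S.erase i, by simp, Finset.insert_erase hi⟩
    have hik : i ≠ k := fun h => hk (h ▸ hi)
    have hkT : k ∉ T := fun h => hk (by simp [h])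
    have hikT : i ∉ insert k T := by simp [hik, hiT]
    rw [Finset.erase_insert hiT, if_neg hkT, Finset.insert_comm k i T, Finset.erase_insert hikT,
      smul_smul, ← add_smul]
    convert zero_smul R (w (insert k T))
    rw [koszulSign_insert_self hiT, koszulSign_insert_self hikT, koszulSign_insert hkT,
      koszulSign_insert hiT]
    rcases lt_or_gt_of_ne hik with h | h
    · rw [if_pos h, if_neg h.not_gt]; ring
    · rw [if_pos h, if_neg h.not_gt]; ring

lemma exists_smul_eq_koszulD (x : Fin d → R) (n : ℕ) {p : ℤ} {w : Finset (Fin d) → N}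
    (hw : KoszulDeg p w) (hD : koszulD x n w = 0) {r : R}
    (hr : r ∈ Ideal.span (Set.range fun i => x i ^ n)) :
    ∃ v, KoszulDeg (p - 1) v ∧ r • w = koszulD x n v := by
  induction hr using Submodule.span_induction with
  | mem r h =>
    obtain ⟨k, rfl⟩ := h
    refine ⟨_, hw.contract (R := R) k, ?_⟩
    rw [← koszulD_contract_add, hD]
    have : koszulContract R k (0 : Finset (Fin d) → N) = 0 := by
      ext S; simp [koszulContract]
    rw [this, add_zero]
  | zero => exact ⟨0, fun _ _ => rfl, by simp⟩
  | add r s _ _ h1 h2 =>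
    obtain ⟨v1, h1, e1⟩ := h1
    obtain ⟨v2, h2, e2⟩ := h2
    exact ⟨v1 + v2, h1.add h2, by rw [add_smul, e1, e2, map_add]⟩
  | smul a r _ h =>
    obtain ⟨v, h, e⟩ := h
    exact ⟨a • v, h.smul a, by rw [smul_assoc, e, map_smul]⟩

end Koszul

/-! ### Vanishing of local cohomology -/

section Vanishing

variable {d : ℕ}

/-- Vanishing of `H^p` of the direct limit of the Koszul complexes on `xⁿ`, i.e. of the `p`-th
local cohomology of `N` with support in `(x₁, …, x_d)`. -/
def CohomVanish (x : Fin d → R) (N : Type) [AddCommGroup N] [Module R N] (p : ℤ) : Prop :=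
  ∀ (n : ℕ) (w : Finset (Fin d) → N), KoszulDeg p w → koszulD x n w = 0 →
    ∃ (m : ℕ) (v : Finset (Fin d) → N), KoszulDeg (p - 1) v ∧ koszulT x m w = koszulD x (n + m) v

variable {N : Type} [AddCommGroup N] [Module R N]

lemma cohomVanish_of_neg (x : Fin d → R) {p : ℤ} (hp : p < 0) : CohomVanish x N p :=
  fun _ _ hw _ => ⟨0, 0, fun _ _ => rfl, by rw [hw.eq_zero_of_neg hp, map_zero, map_zero]⟩

lemma cohomVanish_of_subsingleton [Subsingleton N] (x : Fin d → R) (p : ℤ) : CohomVanish x N p :=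
  fun _ _ _ _ => ⟨0, 0, fun _ _ => rfl, Subsingleton.elim _ _⟩

lemma exists_pow_mem_span_pow (x : Fin d → R) {a : R} (ha : a ∈ Ideal.span (Set.range x)) (n : ℕ) :
    ∃ t : ℕ, a ^ t ∈ Ideal.span (Set.range fun i => x i ^ n) := by
  have : Ideal.span (Set.range x) ≤ (Ideal.span (Set.range fun i => x i ^ n)).radical := by
    rw [Ideal.span_le]
    rintro _ ⟨i, rfl⟩
    exact ⟨n, Ideal.subset_span ⟨i, rfl⟩⟩
  exact this ha

lemma CohomVanish.of_quotSMulTop {x : Fin d → R} {a : R} (ha : a ∈ Ideal.span (Set.range x))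
    (hreg : IsSMulRegular N a) {p : ℤ} (h : CohomVanish x (QuotSMulTop a N) (p - 1)) :
    CohomVanish x N p := by
  have key : ∀ (t n : ℕ) (w v : Finset (Fin d) → N), KoszulDeg p w → KoszulDeg (p - 1) v →
      a ^ t • w = koszulD x n v → ∃ (m : ℕ) (v : Finset (Fin d) → N),
        KoszulDeg (p - 1) v ∧ koszulT x m w = koszulD x (n + m) v := by
    intro t
    induction t with
    | zero =>
      intro n w v hw hv e
      exact ⟨0, v, hv, by rw [koszulT_zero]; simpa using e⟩
    | succ t ih =>
      intro n w v hw hv e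
      let q : N →ₗ[R] QuotSMulTop a N := Submodule.mkQ _
      have hqv : koszulD x n (koszulMap d q v) = 0 := by
        rw [← koszulMap_koszulD, ← e]
        ext S
        simp only [koszulMap_apply, Pi.smul_apply, Pi.zero_apply, pow_succ', mul_smul]
        exact (Submodule.Quotient.mk_eq_zero _).2
          (Submodule.smul_mem_pointwise_smul _ _ _ trivial)
      obtain ⟨m, u, hu, eu⟩ := h n _ (hv.map q) hqv
      obtain ⟨u', hu', rfl⟩ := exists_koszulMap_eq q hu fun S => Submodule.mkQ_surjective _ _
      have hker : ∀ S, (koszulT x m v - koszulD x (n + m) u') S ∈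
          LinearMap.range (LinearMap.lsmul R N a) := by
        intro S
        have h0 : q ((koszulT x m v - koszulD x (n + m) u') S) = 0 := by
          rw [Pi.sub_apply, map_sub, ← koszulMap_apply q, ← koszulMap_apply q,
            koszulMap_koszulT, koszulMap_koszulD, eu, sub_self]
        obtain ⟨y, -, hy⟩ := (Submodule.Quotient.mk_eq_zero _).1 h0
        exact ⟨y, hy⟩
      have hdeg : KoszulDeg (p - 1) (koszulT x m v - koszulD x (n + m) u') := by
        refine (hv.trans x m).sub ?_
        simpa using hu'.diff x (n + m)
      obtain ⟨v', hv', ev'⟩ := exists_koszulMap_eq _ hdeg hker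
      have e' : a ^ t • koszulT x m w = koszulD x (n + m) v' := by
        ext S
        apply hreg
        have : koszulD x (n + m) (koszulMap d (LinearMap.lsmul R N a) v') =
            a ^ (t + 1) • koszulT x m w := by
          rw [ev', map_sub, koszulD_koszulD, sub_zero, koszulD_koszulT, ← e, map_smul]
        have := congrFun this S
        rw [← koszulMap_koszulD] at this
        simp only [koszulMap_apply, LinearMap.lsmul_apply, Pi.smul_apply] at this ⊢
        rw [this, pow_succ', mul_smul]
      obtain ⟨m', v'', hv'', e''⟩ := ih (n + m) _ v' (hw.trans x m) hv' e'
      exact ⟨m + m', v'', hv'', by rw [← koszulT_koszulT, e'', add_assoc]⟩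
  intro n w hw hD
  obtain ⟨t, ht⟩ := exists_pow_mem_span_pow x ha n
  obtain ⟨v, hv, e⟩ := exists_smul_eq_koszulD x n hw hD ht
  exact key t n w v hw hv e

/-- Local cohomology vanishes below the depth. -/
lemma cohomVanish_of_isWeaklyRegular {x : Fin d → R} (rs : List R)
    (hrs : ∀ r ∈ rs, r ∈ Ideal.span (Set.range x)) :
    ∀ (N : Type) [AddCommGroup N] [Module R N], RingTheory.Sequence.IsWeaklyRegular N rs →
      ∀ p : ℤ, p < rs.length → CohomVanish x N p := by
  induction rs with
  | nil => exact fun N _ _ _ p hp => cohomVanish_of_neg x (by simpa using hp)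
  | cons r rs ih =>
    intro N _ _ h p hp
    rw [RingTheory.Sequence.isWeaklyRegular_cons_iff] at h
    refine .of_quotSMulTop (hrs r (by simp)) h.1 (ih (fun s hs => hrs s (by simp [hs])) _ h.2 _ ?_)
    rw [List.length_cons] at hp
    push_cast at hp
    omega

/-- The submodule of elements killed by a power of each `x i`. -/
def powTorsion (x : Fin d → R) (N : Type) [AddCommGroup N] [Module R N] : Submodule R N where
  carrier := { y | ∃ n : ℕ, ∀ i, x i ^ n • y = 0 }
  zero_mem' := ⟨0, fun i => smul_zero _⟩
  add_mem' := by
    rintro a b ⟨n, hn⟩ ⟨m, hm⟩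
    refine ⟨n + m, fun i => ?_⟩
    rw [smul_add, pow_add, mul_smul, mul_smul, hm, smul_comm, hn, smul_zero, smul_zero, add_zero]
  smul_mem' := by
    rintro c y ⟨n, hn⟩
    exact ⟨n, fun i => by rw [smul_comm, hn, smul_zero]⟩

lemma pow_smul_eq_zero_of_le {r : R} {y : N} {n m : ℕ} (hnm : n ≤ m) (h : r ^ n • y = 0) :
    r ^ m • y = 0 := by
  rw [← Nat.sub_add_cancel hnm, pow_add, mul_smul, h, smul_zero]

/-- Dividing out the torsion does not change local cohomology in positive degrees. -/
lemma CohomVanish.of_quotient_powTorsion {x : Fin d → R} {p : ℤ} (hp : 1 ≤ p)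
    (h : CohomVanish x (N ⧸ powTorsion x N) p) : CohomVanish x N p := by
  intro n w hw hD
  let q : N →ₗ[R] N ⧸ powTorsion x N := Submodule.mkQ _
  obtain ⟨m, u, hu, eu⟩ := h n _ (hw.map q) (by rw [← koszulMap_koszulD, hD, map_zero])
  obtain ⟨v, hv, rfl⟩ := exists_koszulMap_eq q hu fun S => Submodule.mkQ_surjective _ _
  have htors : ∀ S, (koszulT x m w - koszulD x (n + m) v) S ∈ powTorsion x N := by
    intro S
    have h0 : q ((koszulT x m w - koszulD x (n + m) v) S) = 0 := by
      rw [Pi.sub_apply, map_sub, ← koszulMap_apply q, ← koszulMap_apply q,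
        koszulMap_koszulT, koszulMap_koszulD, eu, sub_self]
    exact (Submodule.Quotient.mk_eq_zero _).1 h0
  choose k hk using htors
  have hdeg : KoszulDeg p (koszulT x m w - koszulD x (n + m) v) := by
    refine (hw.trans x m).sub ?_
    simpa using hv.diff x (n + m)
  refine ⟨m + Finset.univ.sup k, koszulT x (Finset.univ.sup k) v, hv.trans _ _, ?_⟩
  rw [← add_assoc, koszulD_koszulT, ← koszulT_koszulT, ← sub_eq_zero, ← map_sub]
  ext S
  by_cases hS : (S.card : ℤ) = p
  · obtain ⟨i, hi⟩ : S.Nonempty := Finset.card_pos.1 (by omega)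
    rw [koszulT_apply, ← Finset.mul_prod_erase S _ hi, mul_comm, mul_smul,
      pow_smul_eq_zero_of_le (Finset.le_sup (f := k) (Finset.mem_univ S)) (hk S i), smul_zero]
    rfl
  · rw [koszulT_apply, hdeg S hS, smul_zero]
    rfl

/-- A finitely generated module without torsion has a regular element in the ideal. -/
lemma exists_isSMulRegular_of_powTorsion [IsNoetherianRing R] [Module.Finite R N] {x : Fin d → R}
    (h : powTorsion x N = ⊥) : ∃ a ∈ Ideal.span (Set.range x), IsSMulRegular N a := by
  by_contra! hcon
  have hsub : ((Ideal.span (Set.range x) : Ideal R) : Set R) ⊆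
      ⋃ P ∈ associatedPrimes R N, (P : Set R) := by
    rw [biUnion_associatedPrimes_eq_zero_divisors]
    intro a ha
    have := hcon a ha
    rw [isSMulRegular_iff_right_eq_zero_of_smul] at this
    push Not at this
    obtain ⟨y, hy, hy0⟩ := this
    exact ⟨y, hy0, hy⟩
  obtain ⟨P, hP, hle⟩ := (Ideal.subset_union_prime_finite (associatedPrimes.finite R N)
    (f := id) 0 0 fun _ h _ _ => h.1).1 hsub
  rw [AssociatedPrimes.mem_iff, isAssociatedPrime_iff] at hP
  obtain ⟨prime, y, rfl⟩ := hP
  have hy : y ∈ powTorsion x N := ⟨1, fun i => by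
    have := hle (Ideal.subset_span ⟨i, rfl⟩)
    simpa [Submodule.mem_colon_singleton] using this⟩
  rw [h, Submodule.mem_bot] at hy
  subst hy
  exact prime.ne_top (by ext; simp)

/-- Grothendieck vanishing: local cohomology vanishes above the dimension. -/
lemma cohomVanish_of_supportDim_lt [IsNoetherianRing R] (x : Fin d → R) (b : ℕ) :
    ∀ (N : Type) [AddCommGroup N] [Module R N] [Module.Finite R N],
      Module.supportDim R N < (b : WithBot ℕ∞) → ∀ p : ℤ, b ≤ p → CohomVanish x N p := by
  induction b with
  | zero =>
    intro N _ _ _ h p _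
    have : Subsingleton N := by
      by_contra hN
      rw [not_subsingleton_iff_nontrivial] at hN
      have := Module.supportDim_ne_bot_of_nontrivial R N
      revert h this
      cases Module.supportDim R N <;> simp [← WithBot.coe_zero]
    exact cohomVanish_of_subsingleton x p
  | succ b ih =>
    intro N _ _ _ h p hp
    push_cast at hp
    refine .of_quotient_powTorsion (by omega) ?_
    have hbot : powTorsion x (N ⧸ powTorsion x N) = ⊥ := by
      rw [eq_bot_iff]
      intro y
      obtain ⟨y, rfl⟩ := Submodule.mkQ_surjective _ y
      rintro ⟨n, hn⟩
      rw [Submodule.mem_bot]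
      have hn' : ∀ i, x i ^ n • y ∈ powTorsion x N := fun i =>
        (Submodule.Quotient.mk_eq_zero _).1 (hn i)
      choose m hm using hn'
      refine (Submodule.Quotient.mk_eq_zero _).2 ⟨Finset.univ.sup m + n, fun i => ?_⟩
      rw [pow_add, mul_smul]
      exact pow_smul_eq_zero_of_le (Finset.le_sup (f := m) (Finset.mem_univ i)) (hm i i)
    obtain ⟨a, ha, hreg⟩ := exists_isSMulRegular_of_powTorsion hbot
    refine .of_quotSMulTop ha hreg (ih _ ?_ _ (by omega))
    have h1 := Module.supportDim_quotSMulTop_succ_le_of_notMem_minimalPrimes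
      (R := R) (M := N ⧸ powTorsion x N) (fun _ => hreg.notMem_of_mem_minimalPrimes)
    have h2 := (h1.trans (Module.supportDim_le_of_surjective (powTorsion x N).mkQ
      (Submodule.mkQ_surjective _))).trans_lt h
    push_cast at h2
    exact lt_of_add_lt_add_right h2

end Vanishing

/-! ### Zigzags in the double complex -/

section Zigzag

variable {d : ℕ} (x : Fin d → R) {M : Type} [AddCommGroup M] [Module R M]
  {C : ℕ → Type} [∀ j, AddCommGroup (C j)] [∀ j, Module R (C j)]
  (dl : ∀ j, C (j + 1) →ₗ[R] C j) (π : C 0 →ₗ[R] M)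

/-- `Zigzag x dl π z n j y` says that `z : M` and the Koszul cocycle `y` of degree `j + 1` with
coefficients in `C j` are linked by a zigzag through the double complex of Koszul cochains on
`xⁿ` with coefficients in `C_•`. -/
def Zigzag (z : M) (n : ℕ) : (j : ℕ) → (Finset (Fin d) → C j) → Prop
  | 0, y => ∃ c : Finset (Fin d) → C 0, KoszulDeg 0 c ∧ y = koszulD x n c ∧ π (c ∅) = z
  | j + 1, y => ∃ c : Finset (Fin d) → C (j + 1), KoszulDeg ((j : ℤ) + 1) c ∧
      y = koszulD x n c ∧ Zigzag z n j (koszulMap d (dl j) c)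

variable {x dl π}

lemma Zigzag.isCocycle {z : M} {n : ℕ} : ∀ {j : ℕ} {y : Finset (Fin d) → C j},
    Zigzag x dl π z n j y → koszulD x n y = 0 := by
  rintro (_ | j) y ⟨c, _, rfl, _⟩ <;> exact koszulD_koszulD x n c

lemma Zigzag.koszulDeg {z : M} {n : ℕ} : ∀ {j : ℕ} {y : Finset (Fin d) → C j},
    Zigzag x dl π z n j y → KoszulDeg ((j : ℤ) + 1) y := by
  rintro (_ | j) y ⟨c, hc, rfl, _⟩ <;> simpa using hc.diff x n

lemma Zigzag.sub {z z' : M} {n : ℕ} : ∀ {j : ℕ} {y y' : Finset (Fin d) → C j},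
    Zigzag x dl π z n j y → Zigzag x dl π z' n j y' → Zigzag x dl π (z - z') n j (y - y') := by
  intro j
  induction j with
  | zero =>
    rintro _ _ ⟨c, hc, rfl, rfl⟩ ⟨c', hc', rfl, rfl⟩
    exact ⟨c - c', hc.sub hc', (map_sub _ _ _).symm, map_sub _ _ _⟩
  | succ j ih =>
    rintro _ _ ⟨c, hc, rfl, h⟩ ⟨c', hc', rfl, h'⟩
    exact ⟨c - c', hc.sub hc', (map_sub _ _ _).symm, by rw [map_sub]; exact ih h h'⟩

lemma Zigzag.smul {z : M} {n : ℕ} (r : R) : ∀ {j : ℕ} {y : Finset (Fin d) → C j},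
    Zigzag x dl π z n j y → Zigzag x dl π (r • z) n j (r • y) := by
  intro j
  induction j with
  | zero =>
    rintro _ ⟨c, hc, rfl, rfl⟩
    exact ⟨r • c, hc.smul r, (map_smul _ _ _).symm, map_smul _ _ _⟩
  | succ j ih =>
    rintro _ ⟨c, hc, rfl, h⟩
    exact ⟨r • c, hc.smul r, (map_smul _ _ _).symm, by rw [map_smul]; exact ih h⟩

lemma Zigzag.trans {z : M} {n : ℕ} (m : ℕ) : ∀ {j : ℕ} {y : Finset (Fin d) → C j},
    Zigzag x dl π z n j y → Zigzag x dl π z (n + m) j (koszulT x m y) := by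
  intro j
  induction j with
  | zero =>
    rintro _ ⟨c, hc, rfl, rfl⟩
    exact ⟨koszulT x m c, hc.trans x m, (koszulD_koszulT x n m c).symm, by
      rw [koszulT_of_deg_zero x m hc]⟩
  | succ j ih =>
    rintro _ ⟨c, hc, rfl, h⟩
    exact ⟨koszulT x m c, hc.trans x m, (koszulD_koszulT x n m c).symm, by
      rw [koszulMap_koszulT]; exact ih h⟩

lemma smul_eq_zero_of_koszulD_eq_zero {N : Type} [AddCommGroup N] [Module R N] {n : ℕ}
    {c : Finset (Fin d) → N} (h : koszulD x n c = 0) (i : Fin d) : x i ^ n • c ∅ = 0 := by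
  have := congrFun h {i}
  rw [koszulD_apply, Finset.sum_singleton] at this
  simpa [koszulSign, Finset.filter_singleton] using this

lemma koszulD_eq_zero_of_smul_eq_zero {N : Type} [AddCommGroup N] [Module R N] {n : ℕ}
    {c : Finset (Fin d) → N} (hc : KoszulDeg 0 c) (h : ∀ i, x i ^ n • c ∅ = 0) :
    koszulD x n c = 0 := by
  ext S
  refine Finset.sum_eq_zero fun i hi => ?_
  by_cases hS : S.erase i = ∅
  · rw [hS, mul_smul, h, smul_zero]
  · rw [hc _ (by simpa using hS), smul_zero]

/-- A torsion element is linked by zigzags to cocycles of every degree `j + 1 ≤ d`. -/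
lemma exists_zigzag (hπsurj : Function.Surjective π)
    (hπker : LinearMap.ker π = LinearMap.range (dl 0)) {z : M} (hz : z ∈ powTorsion x M) (J : ℕ)
    (hH : ∀ j < J, CohomVanish x (Hmod C dl j) ((j : ℤ) + 2)) :
    ∀ j ≤ J, ∃ (n : ℕ) (y : Finset (Fin d) → C j), Zigzag x dl π z n j y ∧
      ∀ S, y S ∈ LinearMap.range (dl j) := by
  intro j
  induction j with
  | zero =>
    intro _
    obtain ⟨n, hn⟩ := hz
    obtain ⟨c, rfl⟩ := hπsurj z
    have hc : KoszulDeg 0 (Pi.single ∅ c : Finset (Fin d) → C 0) := KoszulDeg.single ∅ c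
    refine ⟨n, koszulD x n (Pi.single ∅ c), ⟨_, hc, rfl, by simp⟩, fun S => ?_⟩
    rw [← hπker, LinearMap.mem_ker, ← koszulMap_apply π, koszulMap_koszulD,
      koszulD_eq_zero_of_smul_eq_zero (hc.map π) (by simpa [koszulMap_apply] using hn)]
    rfl
  | succ j ih =>
    intro hj
    obtain ⟨n, y, hzy, hy⟩ := ih (by omega)
    obtain ⟨c, hc, rfl⟩ := exists_koszulMap_eq (dl j) hzy.koszulDeg hy
    have hcyc : koszulMap d (dl j) (koszulD x n c) = 0 := by
      rw [koszulMap_koszulD, hzy.isCocycle]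
    obtain ⟨w, hw, ew⟩ := exists_koszulMap_eq (LinearMap.ker (dl j)).subtype (hc.diff x n)
      fun S => by
        rw [Submodule.range_subtype]
        exact congrFun hcyc S
    have hwD : koszulD x n w = 0 := by
      ext S
      have : koszulMap d (LinearMap.ker (dl j)).subtype (koszulD x n w) = 0 := by
        rw [koszulMap_koszulD, ew, koszulD_koszulD]
      exact congrFun this S
    let q : LinearMap.ker (dl j) →ₗ[R] Hmod C dl j := Submodule.mkQ _
    obtain ⟨m, u, hu, eu⟩ := hH j (by omega) n (koszulMap d q w)
      (by
        refine KoszulDeg.map q ?_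
        rwa [add_assoc] at hw)
      (by rw [← koszulMap_koszulD, hwD, map_zero])
    obtain ⟨v, hv, rfl⟩ := exists_koszulMap_eq q hu fun S => Submodule.mkQ_surjective _ _
    have hv' : KoszulDeg ((j : ℤ) + 1) (koszulMap d (LinearMap.ker (dl j)).subtype v) := by
      have := hv.map (LinearMap.ker (dl j)).subtype
      rwa [show (j : ℤ) + 2 - 1 = j + 1 by ring] at this
    have hvker : koszulMap d (dl j) (koszulMap d (LinearMap.ker (dl j)).subtype v) = 0 := by
      ext S
      exact (v S).2
    refine ⟨n + m, koszulD x (n + m)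
      (koszulT x m c - koszulMap d (LinearMap.ker (dl j)).subtype v),
      ⟨_, (hc.trans x m).sub hv', rfl, ?_⟩, fun S => ?_⟩
    · rw [map_sub, hvker, sub_zero, koszulMap_koszulT]
      exact hzy.trans m
    · have h0 : q ((koszulT x m w - koszulD x (n + m) v) S) = 0 := by
        rw [Pi.sub_apply, map_sub, ← koszulMap_apply q, ← koszulMap_apply q,
          koszulMap_koszulT, koszulMap_koszulD, eu, sub_self]
      have h1 : ((koszulT x m w - koszulD x (n + m) v) S : C (j + 1)) ∈
          LinearMap.range (dl (j + 1)) :=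
        (Submodule.Quotient.mk_eq_zero (Submodule.comap (LinearMap.ker (dl j)).subtype
          (LinearMap.range (dl (j + 1))))).1 h0
      rw [map_sub, koszulD_koszulT, ← ew, ← koszulMap_koszulT, ← koszulMap_koszulD, ← map_sub]
      exact h1

/-- A Koszul coboundary with values in the boundaries of `C_•` comes from a torsion element. -/
lemma exists_mem_powTorsion_zigzag (hcomplex : ∀ j, (dl j).comp (dl (j + 1)) = 0)
    (hπker : LinearMap.ker π = LinearMap.range (dl 0)) :
    ∀ (j : ℕ), (∀ i < j, CohomVanish x (C i) ((i : ℤ) + 1)) →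
    ∀ (n : ℕ) (c : Finset (Fin d) → C j), KoszulDeg (j : ℤ) c →
      (∀ S, koszulD x n c S ∈ LinearMap.range (dl j)) →
      ∃ z ∈ powTorsion x M, ∃ m, Zigzag x dl π z (n + m) j (koszulT x m (koszulD x n c)) := by
  intro j
  induction j with
  | zero =>
    intro _ n c hc h
    refine ⟨π (c ∅), ⟨n, fun i => ?_⟩, 0, c, by simpa using hc, by rw [koszulT_zero]; rfl, rfl⟩
    refine smul_eq_zero_of_koszulD_eq_zero (c := koszulMap d π c) ?_ i
    rw [← koszulMap_koszulD]
    ext S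
    have := h S
    rwa [← hπker] at this
  | succ j ih =>
    intro hC n c hc h
    have hcyc : koszulD x n (koszulMap d (dl j) c) = 0 := by
      rw [← koszulMap_koszulD]
      ext S
      obtain ⟨u, hu⟩ := h S
      rw [koszulMap_apply, ← hu]
      exact LinearMap.congr_fun (hcomplex j) u
    push_cast at hc
    obtain ⟨m, c', hc', e⟩ := hC j (by omega) n _ (hc.map (dl j)) hcyc
    obtain ⟨z, hz, m', hzig⟩ := ih (fun i hi => hC i (by omega)) (n + m) c' (by simpa using hc')
      (fun S => by rw [← e, ← koszulMap_koszulT]; exact ⟨_, rfl⟩)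
    refine ⟨z, hz, m + m', koszulT x (m + m') c, hc.trans x _, (koszulD_koszulT x n _ c).symm, ?_⟩
    rwa [koszulMap_koszulT, ← koszulT_koszulT, e, ← add_assoc]

/-- A zigzag ending in a coboundary of boundaries starts in zero. -/
lemma Zigzag.eq_zero (hcomplex : ∀ j, (dl j).comp (dl (j + 1)) = 0)
    (hπker : LinearMap.ker π = LinearMap.range (dl 0)) {z : M} :
    ∀ (j : ℕ), (∀ i ≤ j, CohomVanish x (C i) (i : ℤ)) →
    ∀ (n : ℕ) (h : Finset (Fin d) → C j), KoszulDeg (j : ℤ) h →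
      (∀ S, h S ∈ LinearMap.range (dl j)) →
      Zigzag x dl π z n j (koszulD x n h) → z = 0 := by
  intro j
  induction j with
  | zero =>
    rintro hC n h hdeg hker ⟨c, hc, e, rfl⟩
    obtain ⟨m, v, hv, ev⟩ := hC 0 le_rfl n (h - c) (hdeg.sub (by simpa using hc))
      (by rw [map_sub, e, sub_self])
    rw [koszulT_of_deg_zero x m (hdeg.sub (by simpa using hc)), hv.eq_zero_of_neg (by simp),
      map_zero, sub_eq_zero] at ev
    rw [← ev]
    exact hπker.ge (hker ∅)
  | succ j ih =>
    rintro hC n h hdeg hker ⟨c, hc, e, hzig⟩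
    push_cast at hdeg
    obtain ⟨m, g, hg, eg⟩ := hC (j + 1) le_rfl n (c - h) (by push_cast; exact hc.sub hdeg)
      (by rw [map_sub, e, sub_self])
    have hg' : KoszulDeg (j : ℤ) g := by simpa using hg
    refine ih (fun i hi => hC i (by omega)) (n + m) (koszulMap d (dl j) g) (hg'.map _)
      (fun S => ⟨g S, rfl⟩) ?_
    · have hh : koszulMap d (dl j) h = 0 := funext fun S => by
        obtain ⟨u, hu⟩ := hker S
        rw [koszulMap_apply, ← hu]
        exact LinearMap.congr_fun (hcomplex j) u
      have := hzig.trans m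
      rwa [← koszulMap_koszulT, ← sub_zero (koszulMap d (dl j) (koszulT x m c)),
        ← map_zero (koszulT x m), ← hh, ← koszulMap_koszulT, ← map_sub, ← map_sub, eg,
        koszulMap_koszulD] at this

end Zigzag

/-! ### Homogeneous components -/

section Graded

/-- The homogeneous component of degree `e`. -/
def component {M : Type} [AddCommGroup M] (ℳ : ℤ → AddSubgroup M) [DirectSum.Decomposition ℳ]
    (e : ℤ) : M →+ M where
  toFun y := DirectSum.decompose ℳ y e
  map_zero' := by simp
  map_add' := by simp

section

variable {M M' : Type} [AddCommGroup M] [AddCommGroup M'] (ℳ : ℤ → AddSubgroup M)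
  [DirectSum.Decomposition ℳ] (ℳ' : ℤ → AddSubgroup M') [DirectSum.Decomposition ℳ']

lemma component_mem (e : ℤ) (y : M) : component ℳ e y ∈ ℳ e := (DirectSum.decompose ℳ y e).2

variable {ℳ} in
lemma component_of_mem {i : ℤ} {y : M} (hy : y ∈ ℳ i) (e : ℤ) :
    component ℳ e y = if i = e then y else 0 := by
  split_ifs with h
  · subst h
    exact DirectSum.decompose_of_mem_same ℳ hy
  · exact DirectSum.decompose_of_mem_ne ℳ hy h

lemma mem_of_component_mem (T : AddSubgroup M) {y : M} (h : ∀ e, component ℳ e y ∈ T) :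
    y ∈ T := by
  classical
  rw [← DirectSum.sum_support_decompose ℳ y]
  exact sum_mem fun e _ => h e

variable {ℳ ℳ'} in
lemma component_map (f : M →+ M') (hf : ∀ i, ∀ y ∈ ℳ i, f y ∈ ℳ' i) (e : ℤ) (y : M) :
    component ℳ' e (f y) = f (component ℳ e y) := by
  induction y using DirectSum.Decomposition.inductionOn ℳ with
  | zero => simp
  | @homogeneous i m =>
    rw [component_of_mem m.2, component_of_mem (hf i _ m.2)]
    split_ifs <;> simp
  | add m m' h h' => simp only [map_add, h, h']

variable [Module R M] {𝒜 : ℤ → AddSubgroup R} [SetLike.GradedSMul 𝒜 ℳ] {ℳ}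

lemma component_smul_of_left_mem {i : ℤ} {r : R} (hr : r ∈ 𝒜 i) (e : ℤ) (y : M) :
    component ℳ (i + e) (r • y) = r • component ℳ e y := by
  induction y using DirectSum.Decomposition.inductionOn ℳ with
  | zero => simp
  | @homogeneous j m =>
    rw [component_of_mem m.2,
      component_of_mem (show r • (m : M) ∈ ℳ (i + j) from SetLike.GradedSMul.smul_mem hr m.2)]
    simp only [add_right_inj]
    split_ifs <;> simp
  | add m m' h h' => simp only [smul_add, map_add, h, h']

lemma component_smul_of_right_mem [GradedRing 𝒜] {j : ℤ} {y : M} (hy : y ∈ ℳ j) (e : ℤ) (r : R) :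
    component ℳ (e + j) (r • y) = component 𝒜 e r • y := by
  induction r using DirectSum.Decomposition.inductionOn 𝒜 with
  | zero => simp
  | @homogeneous i m =>
    rw [component_of_mem m.2,
      component_of_mem (show (m : R) • y ∈ ℳ (i + j) from SetLike.GradedSMul.smul_mem m.2 hy)]
    simp only [add_left_inj]
    split_ifs <;> simp
  | add m m' h h' => simp only [add_smul, map_add, h, h']

end

variable {𝒜 : ℤ → AddSubgroup R} [GradedRing 𝒜] {d : ℕ} {x : Fin d → R}

/-- The component of internal degree `δ` of a Koszul cochain on `xⁿ`. -/
def koszulComponent (d : ℕ) {M : Type} [AddCommGroup M] (ℳ : ℤ → AddSubgroup M)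
    [DirectSum.Decomposition ℳ] (δ : ℤ) (n : ℕ) (w : Finset (Fin d) → M) (S : Finset (Fin d)) : M :=
  component ℳ (n * S.card + δ) (w S)

lemma koszulComponent_mem {M : Type} [AddCommGroup M] (ℳ : ℤ → AddSubgroup M)
    [DirectSum.Decomposition ℳ] (δ : ℤ) (n : ℕ) (w : Finset (Fin d) → M) (S : Finset (Fin d)) :
    koszulComponent d ℳ δ n w S ∈ ℳ (n * S.card + δ) :=
  component_mem ℳ _ _

lemma KoszulDeg.component {M : Type} [AddCommGroup M] (ℳ : ℤ → AddSubgroup M)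
    [DirectSum.Decomposition ℳ] (δ : ℤ) (n : ℕ) {p : ℤ} {w : Finset (Fin d) → M}
    (hw : KoszulDeg p w) : KoszulDeg p (koszulComponent d ℳ δ n w) :=
  fun S h => by rw [koszulComponent, hw S h, map_zero]

lemma pow_mem_grade (hx1 : ∀ i, x i ∈ 𝒜 1) (i : Fin d) (n : ℕ) : x i ^ n ∈ 𝒜 n := by
  simpa using SetLike.pow_mem_graded n (hx1 i)

lemma monomial_mem_grade (hx1 : ∀ i, x i ∈ 𝒜 1) {a : R} (ha : a ∈ 𝒜 0) (u : Fin d → ℕ) :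
    a * ∏ i, x i ^ u i ∈ 𝒜 (∑ i, (u i : ℤ)) := by
  rw [← zero_add (∑ i, (u i : ℤ))]
  exact SetLike.mul_mem_graded ha
    (SetLike.prod_mem_graded _ _ _ fun i _ => pow_mem_grade hx1 i (u i))

lemma koszulSign_mul_mem (hx1 : ∀ i, x i ∈ 𝒜 1) (i : Fin d) (n : ℕ) (S : Finset (Fin d)) :
    koszulSign R i S * x i ^ n ∈ 𝒜 n := by
  rcases neg_one_pow_eq_or R (S.filter (· < i)).card with h | h <;>
    simp [koszulSign, h, pow_mem_grade hx1]

lemma koszulComponent_koszulD (hx1 : ∀ i, x i ∈ 𝒜 1) {M : Type} [AddCommGroup M] [Module R M]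
    (ℳ : ℤ → AddSubgroup M) [DirectSum.Decomposition ℳ] [SetLike.GradedSMul 𝒜 ℳ]
    (δ : ℤ) (n : ℕ) (w : Finset (Fin d) → M) :
    koszulComponent d ℳ δ n (koszulD x n w) = koszulD x n (koszulComponent d ℳ δ n w) := by
  ext S
  rw [koszulComponent, koszulD_apply, koszulD_apply, map_sum]
  refine Finset.sum_congr rfl fun i hi => ?_
  have e : (n : ℤ) * S.card + δ = n + (n * (S.erase i).card + δ) := by
    rw [← Finset.card_erase_add_one hi]
    push_cast
    ring
  rw [koszulComponent, e, component_smul_of_left_mem (koszulSign_mul_mem hx1 i n S)]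

lemma koszulComponent_koszulMap {M M' : Type} [AddCommGroup M] [Module R M]
    {ℳ : ℤ → AddSubgroup M} [DirectSum.Decomposition ℳ] [AddCommGroup M'] [Module R M']
    {ℳ' : ℤ → AddSubgroup M'} [DirectSum.Decomposition ℳ'] (f : M →ₗ[R] M')
    (hf : ∀ i, ∀ y ∈ ℳ i, f y ∈ ℳ' i) (δ : ℤ) (n : ℕ) (w : Finset (Fin d) → M) :
    koszulComponent d ℳ' δ n (koszulMap d f w) = koszulMap d f (koszulComponent d ℳ δ n w) := by
  ext S
  exact component_map f.toAddMonoidHom hf _ _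

lemma Zigzag.component (hx1 : ∀ i, x i ∈ 𝒜 1) {M : Type} [AddCommGroup M] [Module R M]
    {ℳ : ℤ → AddSubgroup M} [DirectSum.Decomposition ℳ]
    {C : ℕ → Type} [∀ j, AddCommGroup (C j)] [∀ j, Module R (C j)]
    {dl : ∀ j, C (j + 1) →ₗ[R] C j} {π : C 0 →ₗ[R] M}
    {𝒞 : ∀ j, ℤ → AddSubgroup (C j)}
    [∀ j, DirectSum.Decomposition (𝒞 j)] [∀ j, SetLike.GradedSMul 𝒜 (𝒞 j)]
    (hdl : ∀ (j : ℕ) (ℓ : ℤ), ∀ x ∈ 𝒞 (j + 1) ℓ, dl j x ∈ 𝒞 j ℓ)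
    (hπ : ∀ (ℓ : ℤ), ∀ x ∈ 𝒞 0 ℓ, π x ∈ ℳ ℓ) (δ : ℤ) {n : ℕ} {z : M} :
    ∀ {j : ℕ} {y : Finset (Fin d) → C j}, Zigzag x dl π z n j y →
      Zigzag x dl π (component ℳ δ z) n j (koszulComponent d (𝒞 j) δ n y) := by
  intro j
  induction j with
  | zero =>
    rintro _ ⟨c, hc, rfl, rfl⟩
    refine ⟨_, hc.component (𝒞 0) δ n, koszulComponent_koszulD hx1 _ _ _ _, ?_⟩
    rw [koszulComponent, Finset.card_empty, Nat.cast_zero, mul_zero, zero_add]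
    exact (component_map π.toAddMonoidHom hπ _ _).symm
  | succ j ih =>
    rintro _ ⟨c, hc, rfl, h⟩
    refine ⟨_, hc.component (𝒞 (j + 1)) δ n, koszulComponent_koszulD hx1 _ _ _ _, ?_⟩
    rw [← koszulComponent_koszulMap (dl j) (hdl j)]
    exact ih h

lemma component_mem_powTorsion (hx1 : ∀ i, x i ∈ 𝒜 1) {M : Type} [AddCommGroup M] [Module R M]
    (ℳ : ℤ → AddSubgroup M) [DirectSum.Decomposition ℳ] [SetLike.GradedSMul 𝒜 ℳ] {z : M}
    (hz : z ∈ powTorsion x M) (e : ℤ) : component ℳ e z ∈ powTorsion x M := by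
  obtain ⟨n, hn⟩ := hz
  exact ⟨n, fun i => by
    rw [← component_smul_of_left_mem (pow_mem_grade hx1 i n), hn, map_zero]⟩

lemma isNoetherianRing_of_polynomial (hfield : IsField ↥(𝒜 0))
    (hpoly : Function.Surjective (MvPolynomial.eval₂Hom (SetLike.GradeZero.subring 𝒜).subtype x)) :
    IsNoetherianRing R := by
  have : IsField (SetLike.GradeZero.subring 𝒜) := hfield
  let := this.toField
  have : IsNoetherianRing (SetLike.GradeZero.subring 𝒜) := inferInstance
  exact isNoetherianRing_of_surjective _ _ _ hpoly

/-- Every element of large degree lies in the ideal generated by `x₁ⁿ, …, x_dⁿ`. -/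
lemma component_mem_span_pow (hx1 : ∀ i, x i ∈ 𝒜 1)
    (hpoly : Function.Surjective (MvPolynomial.eval₂Hom (SetLike.GradeZero.subring 𝒜).subtype x))
    {n : ℕ} {f : ℤ} (hf : (n : ℤ) * d < f + d) (r : R) :
    component 𝒜 f r ∈ Ideal.span (Set.range fun i => x i ^ n) := by
  obtain ⟨p, rfl⟩ := hpoly r
  induction p using MvPolynomial.induction_on' with
  | monomial u a =>
    rw [MvPolynomial.coe_eval₂Hom, MvPolynomial.eval₂_monomial, Finsupp.prod_fintype _ _ (by simp)]
    rw [Subring.subtype_apply, component_of_mem (monomial_mem_grade hx1 a.2 u)]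
    split_ifs with h
    · have : ∃ i, n ≤ u i := by
        by_contra! hlt
        have : ∑ i, ((u i : ℤ) + 1) ≤ ∑ _i : Fin d, (n : ℤ) :=
          Finset.sum_le_sum fun i _ => by exact_mod_cast hlt i
        rw [Finset.sum_add_distrib] at this
        simp at this h
        linarith
      obtain ⟨i, hi⟩ := this
      refine Ideal.mul_mem_left _ _ (Ideal.mem_of_dvd _ (Finset.dvd_prod_of_mem _
        (Finset.mem_univ i)) (Ideal.mem_of_dvd _ (pow_dvd_pow (x i) hi)
        (Ideal.subset_span ⟨i, rfl⟩)))
    · exact zero_mem _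
  | add p q hp hq =>
    rw [map_add, map_add]
    exact add_mem hp hq

lemma component_eq_zero_of_neg (hx1 : ∀ i, x i ∈ 𝒜 1)
    (hpoly : Function.Surjective (MvPolynomial.eval₂Hom (SetLike.GradeZero.subring 𝒜).subtype x))
    {f : ℤ} (hf : f < 0) (r : R) : component 𝒜 f r = 0 := by
  obtain ⟨p, rfl⟩ := hpoly r
  induction p using MvPolynomial.induction_on' with
  | monomial u a =>
    rw [MvPolynomial.coe_eval₂Hom, MvPolynomial.eval₂_monomial, Finsupp.prod_fintype _ _ (by simp)]
    refine (component_of_mem (monomial_mem_grade hx1 a.2 u) f).trans (if_neg ?_)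
    have : 0 ≤ ∑ i, (u i : ℤ) := Finset.sum_nonneg fun i _ => by positivity
    omega
  | add p q hp hq => rw [map_add, map_add, hp, hq, add_zero]

lemma maxHomIdeal_eq_span (hx1 : ∀ i, x i ∈ 𝒜 1)
    (hpoly : Function.Surjective (MvPolynomial.eval₂Hom (SetLike.GradeZero.subring 𝒜).subtype x))
    (hfield : IsField ↥(𝒜 0)) :
    maxHomIdeal 𝒜 = Ideal.span (Set.range x) := by
  apply le_antisymm
  · rw [maxHomIdeal, Ideal.span_le]
    rintro r (⟨h, hr⟩ | hr)
    · have : (⟨r, h⟩ : 𝒜 0) = 0 := by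
        by_contra h0
        obtain ⟨b, hb⟩ := hfield.mul_inv_cancel h0
        exact hr (IsUnit.of_mul_eq_one b hb)
      have : r = 0 := congrArg Subtype.val this
      rw [this]
      exact zero_mem _
    · simp only [Set.mem_iUnion] at hr
      obtain ⟨i, hi, hr⟩ := hr
      have hcomp : component 𝒜 i r = r := by rw [component_of_mem hr, if_pos rfl]
      rcases lt_or_gt_of_ne hi with h | h
      · rw [← hcomp, component_eq_zero_of_neg hx1 hpoly h]
        exact zero_mem _
      · have := component_mem_span_pow hx1 hpoly (n := 1) (f := i) (by push_cast; omega) r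
        rw [hcomp] at this
        simpa using this
  · rw [Ideal.span_le]
    rintro _ ⟨i, rfl⟩
    exact Ideal.subset_span (Or.inr (Set.mem_iUnion₂.2 ⟨1, one_ne_zero, hx1 i⟩))

lemma torsionSubmodule_eq_powTorsion (hx1 : ∀ i, x i ∈ 𝒜 1)
    (hpoly : Function.Surjective (MvPolynomial.eval₂Hom (SetLike.GradeZero.subring 𝒜).subtype x))
    (hfield : IsField ↥(𝒜 0)) (M : Type) [AddCommGroup M]
    [Module R M] : torsionSubmodule (maxHomIdeal 𝒜) M = powTorsion x M := by
  rw [maxHomIdeal_eq_span hx1 hpoly hfield]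
  ext z
  constructor
  · rintro ⟨t, ht⟩
    exact ⟨t, fun i => ht _ (Ideal.pow_mem_pow (Ideal.subset_span (Set.mem_range_self i)) t)⟩
  · rintro ⟨n, hn⟩
    have hrad : Ideal.span (Set.range x) ≤ (Ideal.span (Set.range fun i => x i ^ n)).radical :=
      fun a ha => exists_pow_mem_span_pow x ha n
    obtain ⟨t, ht⟩ := Ideal.exists_pow_le_of_le_radical_of_fg hrad
      (Submodule.fg_span (Set.finite_range x))
    refine ⟨t, fun r hr => ?_⟩
    have hle : Ideal.span (Set.range fun i => x i ^ n) ≤ LinearMap.ker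
        (LinearMap.toSpanSingleton R M z) := by
      rw [Ideal.span_le]
      rintro _ ⟨i, rfl⟩
      exact hn i
    exact hle (ht hr)

lemma mem_smul_top_of_genDegLE (hx1 : ∀ i, x i ∈ 𝒜 1)
    (hpoly : Function.Surjective (MvPolynomial.eval₂Hom (SetLike.GradeZero.subring 𝒜).subtype x))
    {C : Type} [AddCommGroup C] [Module R C]
    {𝒞 : ℤ → AddSubgroup C} [DirectSum.Decomposition 𝒞] [SetLike.GradedSMul 𝒜 𝒞] {β : ℤ}
    (h : GenDegLE (R := R) 𝒞 β) {n : ℕ} {e : ℤ} (he : β + n * d < e + d) {y : C}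
    (hy : y ∈ 𝒞 e) :
    y ∈ Ideal.span (Set.range fun i => x i ^ n) • (⊤ : Submodule R C) := by
  have key : ∀ u : C, component 𝒞 e u ∈
      Ideal.span (Set.range fun i => x i ^ n) • (⊤ : Submodule R C) := by
    intro u
    have hu : u ∈ Submodule.span R (⋃ (j : ℤ) (_ : j ≤ β), (𝒞 j : Set C)) := h ▸ trivial
    induction hu using Submodule.closure_induction with
    | zero => rw [map_zero]; exact zero_mem _
    | add a b _ _ ha hb => rw [map_add]; exact add_mem ha hb
    | smul_mem r g hg =>
      simp only [Set.mem_iUnion] at hg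
      obtain ⟨j, hj, hg⟩ := hg
      rw [← sub_add_cancel e j, component_smul_of_right_mem (𝒜 := 𝒜) hg]
      exact Submodule.smul_mem_smul (component_mem_span_pow hx1 hpoly (by omega) r) trivial
  have := key y
  rwa [component_of_mem hy, if_pos rfl] at this

lemma exists_koszulD_eq_of_mem_smul_top (x : Fin d → R) {C : Type} [AddCommGroup C] [Module R C]
    (n : ℕ) {y : Finset (Fin d) → C} (hy : KoszulDeg (d : ℤ) y)
    (h : y Finset.univ ∈ Ideal.span (Set.range fun i => x i ^ n) • (⊤ : Submodule R C)) :
    ∃ c, KoszulDeg ((d : ℤ) - 1) c ∧ koszulD x n c = y := by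
  have key : ∀ u ∈ Ideal.span (Set.range fun i => x i ^ n) • (⊤ : Submodule R C),
      ∃ c, KoszulDeg ((d : ℤ) - 1) c ∧
        koszulD x n c = (Pi.single Finset.univ u : Finset (Fin d) → C) := by
    intro u hu
    induction hu using Submodule.smul_induction_on' with
    | smul r hr u _ =>
      have hdeg : KoszulDeg (d : ℤ) (Pi.single Finset.univ u : Finset (Fin d) → C) := by
        simpa using KoszulDeg.single (Finset.univ : Finset (Fin d)) u
      obtain ⟨v, hv, e⟩ := exists_smul_eq_koszulD x n hdeg
        ((hdeg.diff x n).eq_zero_of_lt (by omega)) hr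
      exact ⟨v, hv, by rw [← e, Pi.single_smul]⟩
    | add u _ v _ h1 h2 =>
      obtain ⟨c1, h1, e1⟩ := h1
      obtain ⟨c2, h2, e2⟩ := h2
      exact ⟨c1 + c2, h1.add h2, by rw [map_add, e1, e2, Pi.single_add]⟩
  obtain ⟨c, hc, e⟩ := key _ h
  refine ⟨c, hc, e.trans ?_⟩
  ext S
  by_cases hS : S = Finset.univ
  · subst hS; simp
  · rw [Pi.single_eq_of_ne hS, hy S]
    intro hcard
    exact hS (Finset.card_eq_iff_eq_univ S |>.1 (by simpa using hcard))

end Graded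

/-! ### Generators of the torsion submodule -/

section Generators

lemma koszulT_eq_smul_of_deg_card {d : ℕ} (x : Fin d → R) (m : ℕ) {N : Type} [AddCommGroup N]
    [Module R N] {y : Finset (Fin d) → N} (hy : KoszulDeg (d : ℤ) y) :
    koszulT x m y = (∏ i, x i ^ m) • y := by
  ext S
  rw [koszulT_apply, Pi.smul_apply]
  by_cases hS : S = Finset.univ
  · rw [hS]
  · rw [hy S fun h => hS ((Finset.card_eq_iff_eq_univ S).1 (by simpa using h)), smul_zero,
      smul_zero]

lemma cohomVanish_of_depthGE {d : ℕ} (x : Fin d → R) {N : Type} [AddCommGroup N] [Module R N]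
    {k : ℕ} (h : depthGE (Ideal.span (Set.range x)) N k) {p : ℤ} (hp : p < k) :
    CohomVanish x N p := by
  obtain h | ⟨rs, hlen, hmem, hreg⟩ := h
  · exact cohomVanish_of_subsingleton x p
  · exact cohomVanish_of_isWeaklyRegular rs hmem N hreg.toIsWeaklyRegular p (by rwa [hlen])

lemma cohomVanish_of_modDimLE [IsNoetherianRing R] {d : ℕ} (x : Fin d → R) {N : Type}
    [AddCommGroup N] [Module R N] [Module.Finite R N] {b : ℕ} (h : modDimLE (R := R) N b) {p : ℤ}
    (hp : (b : ℤ) < p) : CohomVanish x N p := by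
  refine cohomVanish_of_supportDim_lt x (b + 1) N ?_ p (by exact_mod_cast hp)
  rw [Module.supportDim_eq_ringKrullDim_quotient_annihilator]
  refine lt_of_le_of_lt h ?_
  change ((b : ℕ∞) : WithBot ℕ∞) < (((b + 1 : ℕ) : ℕ∞) : WithBot ℕ∞)
  exact_mod_cast Nat.lt_succ_self b

variable {𝒜 : ℤ → AddSubgroup R} [GradedRing 𝒜] {M : Type} [AddCommGroup M] [Module R M]
  {ℳ : ℤ → AddSubgroup M} [DirectSum.Decomposition ℳ] [SetLike.GradedSMul 𝒜 ℳ]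

/-- If every homogeneous element of the graded submodule `T` of degree larger than `b` is a
multiple of an element of `T` of smaller degree, then `T` is generated in degrees at most `b`. -/
lemma subGenDegLE_of_exists_smul {T : Submodule R M} {b : ℤ}
    (hcomp : ∀ z ∈ T, ∀ e, component ℳ e z ∈ T)
    (h : ∀ e > b, ∀ z ∈ T, z ∈ ℳ e → ∃ (r : R) (z' : M), z' ∈ T ∧ z' ∈ ℳ (e - 1) ∧ r • z' = z) :
    SubGenDegLE (R := R) ℳ T b := by
  have key : ∀ (k : ℕ) (e : ℤ), e ≤ b + k → ∀ z ∈ T, z ∈ ℳ e →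
      z ∈ Submodule.span R (⋃ (j : ℤ) (_ : j ≤ b), ((T : Set M) ∩ (ℳ j : Set M))) := by
    intro k
    induction k with
    | zero =>
      intro e he z hz hze
      exact Submodule.subset_span (Set.mem_iUnion₂.2 ⟨e, by simpa using he, hz, hze⟩)
    | succ k ih =>
      intro e he z hz hze
      rcases le_or_gt e (b + k) with hle | hgt
      · exact ih e hle z hz hze
      · obtain ⟨r, z', hz', hze', rfl⟩ := h e (by omega) z hz hze
        exact Submodule.smul_mem _ r (ih (e - 1) (by push_cast at he; omega) z' hz' hze')
  intro z hz
  refine mem_of_component_mem ℳ (Submodule.span R (⋃ (j : ℤ) (_ : j ≤ b),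
    ((T : Set M) ∩ (ℳ j : Set M)))).toAddSubgroup fun e => ?_
  exact key (e - b).toNat e (by have := Int.self_le_toNat (e - b); omega) _ (hcomp z hz e)
    (component_mem ℳ e z)

variable {C : ℕ → Type} [∀ j, AddCommGroup (C j)] [∀ j, Module R (C j)]
  {dl : ∀ j, C (j + 1) →ₗ[R] C j} {𝒞 : ∀ j, ℤ → AddSubgroup (C j)}
  [∀ j, DirectSum.Decomposition (𝒞 j)] [∀ j, SetLike.GradedSMul 𝒜 (𝒞 j)] {π : C 0 →ₗ[R] M}

/-- A torsion element of degree `δ` linked by zigzags to a Koszul cochain of top degree is a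
multiple of a torsion element of degree `δ - 1` as soon as `δ` is large. -/
lemma exists_smul_of_zigzag {k : ℕ} {x : Fin (k + 1) → R} (hx1 : ∀ i, x i ∈ 𝒜 1)
    (hpoly : Function.Surjective (MvPolynomial.eval₂Hom (SetLike.GradeZero.subring 𝒜).subtype x))
    (hcomplex : ∀ j, (dl j).comp (dl (j + 1)) = 0)
    (hdl : ∀ (j : ℕ) (ℓ : ℤ), ∀ x ∈ 𝒞 (j + 1) ℓ, dl j x ∈ 𝒞 j ℓ)
    (hπker : LinearMap.ker π = LinearMap.range (dl 0))
    (hπ : ∀ (ℓ : ℤ), ∀ x ∈ 𝒞 0 ℓ, π x ∈ ℳ ℓ)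
    (hC : ∀ i < k, CohomVanish x (C i) ((i : ℤ) + 1)) (hC' : ∀ i ≤ k, CohomVanish x (C i) (i : ℤ))
    {β : ℤ} (hβ : GenDegLE (R := R) (𝒞 k) β) {δ : ℤ} (hδ : β - k < δ) {z : M} (hzδ : z ∈ ℳ δ)
    {n : ℕ} {y : Finset (Fin (k + 1)) → C k} (hzy : Zigzag x dl π z n k y)
    (hy : ∀ S, y S ∈ LinearMap.range (dl k)) :
    ∃ (r : R) (z' : M), z' ∈ powTorsion x M ∧ z' ∈ ℳ (δ - 1) ∧ r • z' = z := by
  have hzw := hzy.component hx1 hdl hπ δ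
  rw [component_of_mem hzδ, if_pos rfl] at hzw
  set w := koszulComponent (k + 1) (𝒞 k) δ n y with hw
  have hwdeg : KoszulDeg ((k + 1 : ℕ) : ℤ) w := by exact_mod_cast hzw.koszulDeg
  have hwrange : ∀ S, w S ∈ LinearMap.range (dl k) := fun S => by
    obtain ⟨v, hv⟩ := hy S
    refine ⟨component (𝒞 (k + 1)) (n * S.card + δ) v, ?_⟩
    rw [hw, koszulComponent, ← hv]
    exact (component_map (dl k).toAddMonoidHom (hdl k) _ v).symm
  set P : R := ∏ i : Fin k, x i.succ with hP
  have hPmem : P ∈ 𝒜 k := by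
    simpa using SetLike.prod_mem_graded 𝒜 (fun _ => 1) (fun i : Fin k => x i.succ)
      fun i (_ : i ∈ Finset.univ) => hx1 i.succ
  have hPw : P • w Finset.univ ∈ 𝒞 k (k + n * ((k + 1 : ℕ) : ℤ) + δ) := by
    have hwmem := koszulComponent_mem (𝒞 k) δ n y Finset.univ
    rw [← hw, Finset.card_fin] at hwmem
    have hsmul := SetLike.GradedSMul.smul_mem hPmem hwmem
    rwa [vadd_eq_add, ← add_assoc] at hsmul
  obtain ⟨c, hc, hcw⟩ := exists_koszulD_eq_of_mem_smul_top x (n + 1) (hwdeg.smul P)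
    (mem_smul_top_of_genDegLE hx1 hpoly hβ (by push_cast; linarith) hPw)
  obtain ⟨z', hz', m, hzz'⟩ := exists_mem_powTorsion_zigzag hcomplex hπker k hC (n + 1) c
    (by simpa using hc) fun S => by rw [hcw]; exact Submodule.smul_mem _ P (hwrange S)
  have hdiff := (hzz'.smul (x 0)).sub ((hzw.trans 1).trans m)
  have hzero : x 0 • koszulT x m (koszulD x (n + 1) c) - koszulT x m (koszulT x 1 w) = 0 := by
    rw [hcw, koszulT_eq_smul_of_deg_card x 1 hwdeg, map_smul, map_smul, smul_smul, hP,
      ← Fin.prod_univ_succ]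
    simp
  rw [hzero, ← map_zero (koszulD x (n + 1 + m))] at hdiff
  have hx0 : x 0 • z' = z := sub_eq_zero.1 <| Zigzag.eq_zero hcomplex hπker k hC' _ 0
    (fun _ _ => rfl) (fun _ => zero_mem _) hdiff
  refine ⟨x 0, component ℳ (δ - 1) z', component_mem_powTorsion hx1 ℳ hz' _, component_mem _ _ _,
    ?_⟩
  rw [← component_smul_of_left_mem (hx1 0), hx0, add_sub_cancel, component_of_mem hzδ, if_pos rfl]

end Generators

theorem statement7
    (𝒜 : ℤ → AddSubgroup R) [GradedRing 𝒜]
    (hfield : IsField ↥(𝒜 0))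
    (d : ℕ) (x : Fin d → R) (hx1 : ∀ i, x i ∈ 𝒜 1)
    (hpoly : Function.Bijective
      (MvPolynomial.eval₂Hom (SetLike.GradeZero.subring 𝒜).subtype x))
    (M : Type) [AddCommGroup M] [Module R M]
    (ℳ : ℤ → AddSubgroup M) [DirectSum.Decomposition ℳ] [SetLike.GradedSMul 𝒜 ℳ]
    (C : ℕ → Type) [∀ j, AddCommGroup (C j)] [∀ j, Module R (C j)]
    (hCfin : ∀ j, Module.Finite R (C j))
    (dl : ∀ j, C (j + 1) →ₗ[R] C j)
    (hcomplex : ∀ j, (dl j).comp (dl (j + 1)) = 0)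
    (𝒞 : ∀ j, ℤ → AddSubgroup (C j))
    [∀ j, DirectSum.Decomposition (𝒞 j)] [∀ j, SetLike.GradedSMul 𝒜 (𝒞 j)]
    (hdlhomog : ∀ (j : ℕ) (ℓ : ℤ), ∀ x ∈ 𝒞 (j + 1) ℓ, dl j x ∈ 𝒞 j ℓ)
    (π : C 0 →ₗ[R] M) (hπsurj : Function.Surjective π)
    (hπker : LinearMap.ker π = LinearMap.range (dl 0))
    (hπhomog : ∀ (ℓ : ℤ), ∀ x ∈ 𝒞 0 ℓ, π x ∈ ℳ ℓ)
    -- `dim H_j(C_•) ≤ j` whenever `1 ≤ j ≤ d - 1`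
    (hHdim : ∀ jm1 : ℕ, ((jm1 + 1 : ℕ) : ℤ) ≤ (d : ℤ) - 1 →
      modDimLE (R := R) (Hmod C dl jm1) (jm1 + 1))
    -- `min{d, j + 2} ≤ depth C_j` whenever `0 ≤ j ≤ d - 1`
    (hdepth : ∀ j : ℕ, (j : ℤ) ≤ (d : ℤ) - 1 →
      depthGE (maxHomIdeal 𝒜) (C j) (min d (j + 2))) :
    -- conclusion: `b₀(H⁰_𝔪(M)) ≤ b₀(C_{d-1}) - d + 1`
    ∀ β : ℤ, GenDegLE (R := R) (𝒞 (d - 1)) β →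
      SubGenDegLE (R := R) ℳ (torsionSubmodule (maxHomIdeal 𝒜) M) (β - d + 1) := by
  intro β hβ
  have : IsNoetherianRing R := isNoetherianRing_of_polynomial hfield hpoly.2
  rw [torsionSubmodule_eq_powTorsion hx1 hpoly.2 hfield]
  refine subGenDegLE_of_exists_smul (fun z hz e => component_mem_powTorsion hx1 ℳ hz e) ?_
  intro δ hδ z hz hzδ
  cases d with
  | zero =>
    obtain ⟨c, rfl⟩ := hπsurj z
    have hc := mem_smul_top_of_genDegLE hx1 hpoly.2 hβ (n := 1) (e := δ)
      (by push_cast at hδ ⊢; linarith) (component_mem (𝒞 0) δ c)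
    have hc0 : component (𝒞 0) δ c = 0 := by simpa using hc
    have hz0 : component ℳ δ (π c) = 0 := by
      rw [← π.toAddMonoidHom_coe, component_map π.toAddMonoidHom hπhomog, hc0, map_zero]
    rw [component_of_mem hzδ, if_pos rfl] at hz0
    exact ⟨0, 0, zero_mem _, zero_mem _, by rw [hz0, smul_zero]⟩
  | succ k =>
    rw [maxHomIdeal_eq_span hx1 hpoly.2 hfield] at hdepth
    obtain ⟨n, y, hzy, hy⟩ := exists_zigzag hπsurj hπker hz k
      (fun j hj => cohomVanish_of_modDimLE x (hHdim j (by push_cast; omega))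
        (by push_cast; omega)) k le_rfl
    exact exists_smul_of_zigzag hx1 hpoly.2 hcomplex hdlhomog hπker hπhomog
      (fun i hi => cohomVanish_of_depthGE x (hdepth i (by push_cast; omega))
        (by push_cast; omega))
      (fun i hi => cohomVanish_of_depthGE x (hdepth i (by push_cast; omega))
        (by push_cast; omega))
      hβ (by push_cast at hδ; linarith) hzδ hzy hy

end Paper
end
end

section
/- Let R be a non-negatively graded Cohen-Macaulay ring with R_0 an Artinian local ring, 𝔪 its maximal homogeneous ideal, and d = dim R. Let M be a finitely generated graded R-module of depth zero such that M/H^0_𝔪(M) is a maximal Cohen-Macaulay R-module. Then b_0(H^0_𝔪(M)) ≤ b_0(M) + Θ_d + a(R). -/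
/-!
Statement 9 (Corollary `SJD-cor3` of the paper).

`R` is a non-negatively graded Cohen–Macaulay ring with `R₀ = 𝒜 0` an Artinian local
ring, `𝔪` the maximal homogeneous ideal, `d = dim R`.  `M` is a finitely generated
graded `R`-module of depth zero such that `M / H⁰_𝔪(M)` is a maximal Cohen–Macaulay
module.  Conclusion: `b₀(H⁰_𝔪(M)) ≤ b₀(M) + Θ_d + a(R)`.

Here `Θ_d = Σ_{j=1}^d deg y_j` for a minimal homogeneous generating set `y₁,…,yₙ` of
`𝔪` with `deg y₁ ≥ ⋯ ≥ deg yₙ`, and the `a`-invariant `a(R) = topdeg H^d_𝔪(R)` is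
expressed through the Koszul-cohomology direct-limit predicate `KVanish` (computed on
the generating set `y`).  The inequality is stated in universally quantified form: for
all upper bounds `β ≥ b₀(M)` and `γ ≥ a(R)`, the torsion submodule `H⁰_𝔪(M)` is
generated in degrees `≤ β + Θ_d + γ`.
-/

noncomputable section
namespace Paper

variable {R : Type} [CommRing R]

abbrev KCochain (n : ℕ) (M : Type) (i : ℕ) : Type := {S : Finset (Fin n) // S.card = i} → M

variable {n : ℕ} (y : Fin n → R) {M : Type} [AddCommGroup M] [Module R M]

def kd (t i : ℕ) (f : KCochain n M i) : KCochain n M (i + 1) := fun T =>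
  ∑ j ∈ T.1.attach,
    ((-1 : ℤ) ^ ((T.1.filter (fun a => a < j.1)).card)) •
      ((y j.1 ^ t) • f ⟨T.1.erase j.1, by simp [Finset.card_erase_of_mem j.2, T.2]⟩)

def kTrans (s : ℕ) (i : ℕ) (f : KCochain n M i) : KCochain n M i := fun S =>
  ((∏ j ∈ S.1, y j) ^ s) • f S

def KHomog (ℳ : ℤ → AddSubgroup M) (e : Fin n → ℤ) (t : ℕ) (ℓ : ℤ) {i : ℕ}
    (f : KCochain n M i) : Prop :=
  ∀ S, f S ∈ ℳ (ℓ + (t : ℤ) * ∑ j ∈ S.1, e j)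

def IsKBoundary (t : ℕ) : (i : ℕ) → KCochain n M i → Prop
  | 0, f => f = 0
  | (i + 1), f => ∃ g : KCochain n M i, kd y t i g = f

def KVanish (ℳ : ℤ → AddSubgroup M) (e : Fin n → ℤ) (i : ℕ) (ℓ : ℤ) : Prop :=
  ∀ (t : ℕ) (f : KCochain n M i), kd y t i f = 0 → KHomog ℳ e t ℓ f →
    ∃ s : ℕ, IsKBoundary y (t + s) i (kTrans y s i f)

section KoszulComplex

variable {N P : Type} [AddCommGroup N] [Module R N] [AddCommGroup P] [Module R P]

/-- The Koszul sign of `j` in `T`. -/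
def ksign (R : Type) [CommRing R] {n : ℕ} (T : Finset (Fin n)) (j : Fin n) : R :=
  (-1) ^ (T.filter (fun a => a < j)).card

lemma ksign_mul_self (T : Finset (Fin n)) (j : Fin n) : ksign R T j * ksign R T j = 1 := by
  unfold ksign
  rw [← mul_pow]
  simp

lemma ksign_erase_of_lt {T : Finset (Fin n)} {i j : Fin n} (hi : i ∈ T) (hij : i < j) :
    ksign R (T.erase i) j = -ksign R T j := by
  unfold ksign
  have h : i ∈ T.filter (fun a => a < j) := by simp [hi, hij]
  rw [Finset.filter_erase, ← Finset.card_erase_add_one h, pow_succ]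
  simp

lemma ksign_erase_of_le {T : Finset (Fin n)} {i j : Fin n} (hij : j ≤ i) :
    ksign R (T.erase i) j = ksign R T j := by
  unfold ksign
  rw [Finset.filter_erase, Finset.erase_eq_of_notMem]
  simp [hij]

lemma ksign_anticomm {T : Finset (Fin n)} {i j : Fin n} (hi : i ∈ T) (hj : j ∈ T) (hij : i ≠ j) :
    ksign R T i * ksign R (T.erase i) j = -(ksign R T j * ksign R (T.erase j) i) := by
  rcases lt_or_gt_of_ne hij with h | h
  · rw [ksign_erase_of_lt hi h, ksign_erase_of_le h.le]
    ring
  · rw [ksign_erase_of_lt hj h, ksign_erase_of_le h.le]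
    ring

/-- An antisymmetric double sum over ordered pairs of distinct elements vanishes. -/
lemma sum_sum_erase_eq_zero (T : Finset (Fin n)) (F : Fin n → Fin n → N)
    (hF : ∀ i ∈ T, ∀ j ∈ T, i ≠ j → F i j = -F j i) :
    ∑ i ∈ T, ∑ j ∈ T.erase i, F i j = 0 := by
  rw [Finset.sum_sigma']
  refine Finset.sum_involution (fun a _ => ⟨a.2, a.1⟩) ?_ ?_ ?_ ?_
  · rintro ⟨i, j⟩ h
    simp only [Finset.mem_sigma, Finset.mem_erase] at h
    simp [hF i h.1 j h.2.2 h.2.1.symm]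
  · rintro ⟨i, j⟩ h _ heq
    simp only [Finset.mem_sigma, Finset.mem_erase] at h
    simp only [Sigma.mk.injEq, heq_eq_eq] at heq
    exact h.2.1 heq.1
  · rintro ⟨i, j⟩ h
    simp only [Finset.mem_sigma, Finset.mem_erase] at h ⊢
    exact ⟨h.2.2, h.2.1.symm, h.1⟩
  · rintro ⟨i, j⟩ _
    rfl

/-- The differential of the total Koszul cochain complex of `y₁ᵗ, …, yₙᵗ`. -/
def koszul (N : Type) [AddCommGroup N] [Module R N] (t : ℕ) :
    (Finset (Fin n) → N) →ₗ[R] (Finset (Fin n) → N) where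
  toFun f T := ∑ j ∈ T, (ksign R T j * y j ^ t) • f (T.erase j)
  map_add' f g := by
    ext T
    simp [smul_add, Finset.sum_add_distrib]
  map_smul' r f := by
    ext T
    simp [Finset.smul_sum, smul_comm r]

/-- The transition map from the Koszul complex of `yᵗ` to that of `yᵗ⁺ˢ`. -/
def trans (N : Type) [AddCommGroup N] [Module R N] (s : ℕ) :
    (Finset (Fin n) → N) →ₗ[R] (Finset (Fin n) → N) where
  toFun f T := (∏ j ∈ T, y j) ^ s • f T
  map_add' f g := by
    ext T
    simp
  map_smul' r f := by
    ext T
    simp [smul_comm r]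

/-- The part of cohomological degree `p` of a cochain. -/
def restr (R : Type) [CommRing R] {n : ℕ} (N : Type) [AddCommGroup N] [Module R N] (p : ℕ) :
    (Finset (Fin n) → N) →ₗ[R] (Finset (Fin n) → N) where
  toFun f T := if T.card = p then f T else 0
  map_add' f g := by
    ext T
    by_cases h : T.card = p <;> simp [h]
  map_smul' r f := by
    ext T
    by_cases h : T.card = p <;> simp [h]

lemma koszul_apply (t : ℕ) (f : Finset (Fin n) → N) (T : Finset (Fin n)) :
    koszul y N t f T = ∑ j ∈ T, (ksign R T j * y j ^ t) • f (T.erase j) := rfl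

lemma trans_apply (s : ℕ) (f : Finset (Fin n) → N) (T : Finset (Fin n)) :
    trans y N s f T = (∏ j ∈ T, y j) ^ s • f T := rfl

lemma restr_apply (p : ℕ) (f : Finset (Fin n) → N) (T : Finset (Fin n)) :
    restr R N p f T = if T.card = p then f T else 0 := rfl

lemma koszul_koszul (t : ℕ) (f : Finset (Fin n) → N) : koszul y N t (koszul y N t f) = 0 := by
  ext T
  simp only [koszul_apply, Finset.smul_sum, smul_smul, Pi.zero_apply]
  refine sum_sum_erase_eq_zero T _ fun i hi j hj hij => ?_
  rw [Finset.erase_right_comm, ← neg_smul]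
  congr 1
  linear_combination (y i ^ t * y j ^ t) * ksign_anticomm (R := R) hi hj hij

lemma koszul_trans (t s : ℕ) (f : Finset (Fin n) → N) :
    koszul y N (t + s) (trans y N s f) = trans y N s (koszul y N t f) := by
  ext T
  simp only [koszul_apply, trans_apply, Finset.smul_sum, smul_smul]
  refine Finset.sum_congr rfl fun j hj => ?_
  rw [← Finset.mul_prod_erase T y hj]
  congr 1
  ring

lemma trans_trans (s s' : ℕ) (f : Finset (Fin n) → N) :
    trans y N s' (trans y N s f) = trans y N (s + s') f := by
  ext T
  simp only [trans_apply, smul_smul]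
  congr 1
  ring

lemma trans_zero (f : Finset (Fin n) → N) : trans y N 0 f = f := by
  ext T
  simp [trans_apply]

lemma restr_koszul_succ (t p : ℕ) (f : Finset (Fin n) → N) :
    restr R N (p + 1) (koszul y N t f) = koszul y N t (restr R N p f) := by
  ext T
  simp only [koszul_apply, restr_apply]
  split_ifs with h
  · refine Finset.sum_congr rfl fun j hj => ?_
    rw [if_pos (by rw [Finset.card_erase_of_mem hj, h]; rfl)]
  · refine (Finset.sum_eq_zero fun j hj => ?_).symm
    rw [if_neg, smul_zero]
    intro h'
    exact h (by rw [← Finset.card_erase_add_one hj, h'])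

lemma restr_koszul_zero (t : ℕ) (f : Finset (Fin n) → N) :
    restr R N 0 (koszul y N t f) = 0 := by
  ext T
  simp only [koszul_apply, restr_apply, Finset.card_eq_zero]
  split_ifs with h
  · simp [h]
  · rfl

lemma restr_koszul_mem_range (t p : ℕ) (f : Finset (Fin n) → N) :
    ∃ g, koszul y N t g = restr R N p (koszul y N t f) := by
  cases p with
  | zero => exact ⟨0, by rw [restr_koszul_zero, map_zero]⟩
  | succ p => exact ⟨_, (restr_koszul_succ y t p f).symm⟩

lemma koszul_restr_eq_zero {t : ℕ} {f : Finset (Fin n) → N} (hf : koszul y N t f = 0) (p : ℕ) :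
    koszul y N t (restr R N p f) = 0 := by
  rw [← restr_koszul_succ, hf, map_zero]

lemma restr_trans (s p : ℕ) (f : Finset (Fin n) → N) :
    restr R N p (trans y N s f) = trans y N s (restr R N p f) := by
  ext T
  simp only [trans_apply, restr_apply]
  split_ifs <;> simp

lemma restr_restr (p : ℕ) (f : Finset (Fin n) → N) :
    restr R N p (restr R N p f) = restr R N p f := by
  ext T
  simp only [restr_apply]
  split_ifs <;> simp

lemma koszul_comp (φ : N →ₗ[R] P) (t : ℕ) (f : Finset (Fin n) → N) :
    koszul y P t (φ ∘ f) = φ ∘ koszul y N t f := by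
  ext T
  simp [koszul_apply]

lemma trans_comp (φ : N →ₗ[R] P) (s : ℕ) (f : Finset (Fin n) → N) :
    trans y P s (φ ∘ f) = φ ∘ trans y N s f := by
  ext T
  simp [trans_apply]

lemma restr_comp (φ : N →ₗ[R] P) (p : ℕ) (f : Finset (Fin n) → N) :
    restr R P p (φ ∘ f) = φ ∘ restr R N p f := by
  ext T
  simp only [restr_apply, Function.comp_apply]
  split_ifs <;> simp

/-- `f`, a cochain of the Koszul complex of `yᵗ`, becomes a coboundary in the direct limit. -/
def EvBoundary (t : ℕ) (f : Finset (Fin n) → N) : Prop :=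
  ∃ (s : ℕ) (g : Finset (Fin n) → N), koszul y N (t + s) g = trans y N s f

/-- The degree `p` cohomology of the direct limit of the Koszul complexes vanishes. -/
def CohVanish (N : Type) [AddCommGroup N] [Module R N] (p : ℕ) : Prop :=
  ∀ (t : ℕ) (f : Finset (Fin n) → N), koszul y N t f = 0 → EvBoundary y t (restr R N p f)

variable {y}

lemma exists_boundary_of_le {t s s' : ℕ} (h : s ≤ s') {f g : Finset (Fin n) → N}
    (hg : koszul y N (t + s) g = trans y N s f) :
    ∃ g' : Finset (Fin n) → N, koszul y N (t + s') g' = trans y N s' f := by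
  obtain ⟨k, rfl⟩ := Nat.exists_eq_add_of_le h
  exact ⟨trans y N k g, by rw [← add_assoc, koszul_trans, hg, trans_trans]⟩

lemma EvBoundary.add {t : ℕ} {f f' : Finset (Fin n) → N} (hf : EvBoundary y t f)
    (hf' : EvBoundary y t f') : EvBoundary y t (f + f') := by
  obtain ⟨s, g, hg⟩ := hf
  obtain ⟨s', g', hg'⟩ := hf'
  obtain ⟨a, ha⟩ := exists_boundary_of_le (le_max_left s s') hg
  obtain ⟨b, hb⟩ := exists_boundary_of_le (le_max_right s s') hg'
  exact ⟨max s s', a + b, by rw [map_add, map_add, ha, hb]⟩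

lemma EvBoundary.smul {t : ℕ} {f : Finset (Fin n) → N} (hf : EvBoundary y t f) (r : R) :
    EvBoundary y t (r • f) := by
  obtain ⟨s, g, hg⟩ := hf
  exact ⟨s, r • g, by rw [map_smul, map_smul, hg]⟩

lemma EvBoundary.zero (t : ℕ) : EvBoundary y t (0 : Finset (Fin n) → N) :=
  ⟨0, 0, by simp⟩

lemma EvBoundary.of_trans {t s : ℕ} {f : Finset (Fin n) → N}
    (hf : EvBoundary y (t + s) (trans y N s f)) : EvBoundary y t f := by
  obtain ⟨s', g, hg⟩ := hf
  exact ⟨s + s', g, by rw [← add_assoc, hg, trans_trans]⟩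

lemma EvBoundary.of_koszul {t : ℕ} (g : Finset (Fin n) → N) : EvBoundary y t (koszul y N t g) :=
  ⟨0, g, by rw [add_zero, trans_zero]⟩

lemma EvBoundary.comp {t : ℕ} {f : Finset (Fin n) → N} (hf : EvBoundary y t f) (φ : N →ₗ[R] P) :
    EvBoundary y t (φ ∘ f) := by
  obtain ⟨s, g, hg⟩ := hf
  exact ⟨s, φ ∘ g, by rw [koszul_comp, trans_comp, hg]⟩

lemma EvBoundary.restr {t : ℕ} {f : Finset (Fin n) → N} (hf : EvBoundary y t f) (p : ℕ) :
    EvBoundary y t (restr R N p f) := by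
  obtain ⟨s, g, hg⟩ := hf
  obtain ⟨g', hg'⟩ := restr_koszul_mem_range y (t + s) p g
  exact ⟨s, g', by rw [hg', hg, restr_trans]⟩

lemma EvBoundary.of_pi {ι : Type} [Finite ι] {t : ℕ} {f : Finset (Fin n) → ι → N}
    (hf : ∀ i, EvBoundary y t (fun T => f T i)) : EvBoundary y t f := by
  have := Fintype.ofFinite ι
  choose s g hg using hf
  choose g' hg' using fun i =>
    exists_boundary_of_le (Finset.le_sup (f := s) (Finset.mem_univ i)) (hg i)
  refine ⟨Finset.univ.sup s, fun T i => g' i T, ?_⟩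
  ext T i
  have h := congrFun (hg' i) T
  simpa [koszul_apply, trans_apply] using h

/-- Multiplication by `y jᵗ` is null-homotopic on the Koszul complex of `yᵗ`. -/
lemma exists_koszul_eq_pow_smul {t : ℕ} {f : Finset (Fin n) → N} (hf : koszul y N t f = 0)
    (j : Fin n) : ∃ g, koszul y N t g = y j ^ t • f := by
  refine ⟨fun T => if j ∈ T then 0 else ksign R (insert j T) j • f (insert j T), ?_⟩
  ext T
  rw [koszul_apply, Pi.smul_apply]
  by_cases hj : j ∈ T
  · rw [Finset.sum_eq_single j]
    · simp only [Finset.notMem_erase, if_false, Finset.insert_erase hj, smul_smul]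
      congr 1
      linear_combination (y j ^ t) * ksign_mul_self (R := R) T j
    · intro l hl hlj
      simp [Finset.mem_erase, hlj.symm, hj]
    · exact fun h => absurd hj h
  · have h := congrArg (fun x => ksign R (insert j T) j • x) (congrFun hf (insert j T))
    simp only [koszul_apply, Pi.zero_apply, smul_zero, Finset.sum_insert hj, smul_add,
      Finset.erase_insert hj, Finset.smul_sum, smul_smul] at h
    rw [← mul_assoc, ksign_mul_self, one_mul] at h
    rw [eq_neg_of_add_eq_zero_left h, ← Finset.sum_neg_distrib]
    refine Finset.sum_congr rfl fun l hl => ?_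
    have hlj : l ≠ j := fun h => hj (h ▸ hl)
    have hj' : j ∉ T.erase l := fun h => hj (Finset.mem_of_mem_erase h)
    rw [if_neg hj', smul_smul, ← neg_smul]
    have hins : insert j (T.erase l) = (insert j T).erase l :=
      (Finset.erase_insert_of_ne hlj.symm).symm
    rw [hins]
    congr 1
    have h1 := ksign_anticomm (R := R) (Finset.mem_insert_self j T)
      (Finset.mem_insert_of_mem hl) hlj.symm
    rw [Finset.erase_insert hj] at h1
    have h2 := ksign_mul_self (R := R) (insert j T) l
    have h4 := ksign_mul_self (R := R) T l
    generalize ksign R (insert j T) j = a at *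
    generalize ksign R (insert j T) l = b at *
    generalize ksign R T l = c at *
    generalize ksign R ((insert j T).erase l) j = e' at *
    have h6 : c * e' = -(a * b) := by
      linear_combination (b * c) * h1 - (a * b) * h4 - (c * e') * h2
    linear_combination (y l ^ t) * h6

end KoszulComplex

section Cohomology

variable {n : ℕ} {y : Fin n → R} {N P Q : Type} [AddCommGroup N] [Module R N] [AddCommGroup P]
  [Module R P] [AddCommGroup Q] [Module R Q]

/-- The cohomology of the direct limit is torsion with respect to the ideal generated by `y`. -/
lemma exists_pow_evBoundary {t : ℕ} {f : Finset (Fin n) → N} (hf : koszul y N t f = 0) :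
    ∃ k : ℕ, ∀ r ∈ Ideal.span (Set.range y) ^ k, EvBoundary y t (r • f) := by
  let J : Ideal R :=
    { carrier := {r | EvBoundary y t (r • f)}
      zero_mem' := by simpa using EvBoundary.zero t
      add_mem' := fun ha hb => by simpa [add_smul] using EvBoundary.add ha hb
      smul_mem' := fun c x hx => by simpa [mul_smul] using EvBoundary.smul hx c }
  have hJ : Ideal.span (Set.range y) ≤ J.radical := by
    rw [Ideal.span_le]
    rintro _ ⟨j, rfl⟩
    obtain ⟨g, hg⟩ := exists_koszul_eq_pow_smul hf j
    refine ⟨t, ?_⟩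
    change EvBoundary y t (y j ^ t • f)
    rw [← hg]
    exact EvBoundary.of_koszul g
  obtain ⟨k, hk⟩ := Ideal.exists_pow_le_of_le_radical_of_fg hJ
    ⟨(Set.finite_range y).toFinset, by simp⟩
  exact ⟨k, fun r hr => hk hr⟩

lemma CohVanish.of_subsingleton [Subsingleton N] (p : ℕ) : CohVanish y N p := fun t f _ => by
  rw [Subsingleton.elim (restr R N p f) 0]
  exact EvBoundary.zero t

lemma CohVanish.of_linearEquiv (φ : N ≃ₗ[R] P) {p : ℕ} (h : CohVanish y N p) :
    CohVanish y P p := by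
  intro t f hf
  have h1 := (h t (φ.symm.toLinearMap ∘ f) (by rw [koszul_comp, hf]; ext; simp)).comp φ.toLinearMap
  rw [← restr_comp] at h1
  convert h1 using 2
  ext
  simp

/-- Cohomology vanishes in degrees larger than the number of elements. -/
lemma CohVanish.of_lt {p : ℕ} (hp : n < p) : CohVanish y N p := fun t f _ => by
  have h : Paper.restr R N p f = 0 := by
    ext T
    have : T.card ≠ p := by
      have := card_finset_fin_le T
      omega
    simp [restr_apply, this]
  rw [h]
  exact EvBoundary.zero t

lemma CohVanish.pi {ι : Type} [Finite ι] {p : ℕ} (h : CohVanish y N p) :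
    CohVanish y (ι → N) p := by
  intro t f hf
  exact EvBoundary.of_pi fun i => by
    have := h t (LinearMap.proj (R := R) (φ := fun _ : ι => N) i ∘ f) (by
      rw [koszul_comp, hf]
      rfl)
    rwa [restr_comp] at this

/-- Let `0 → N → P → Q → 0` be exact.  A cocycle of `N` bounding in `P` bounds in `N` if the
preceding cohomology of `Q` vanishes. -/
lemma EvBoundary.of_comp_injective {i : N →ₗ[R] P} {π : P →ₗ[R] Q} (hi : Function.Injective i)
    (hπ : Function.Surjective π) (hex : Function.Exact i π) {p : ℕ}
    (hQ : ∀ q, q + 1 = p → CohVanish y Q q) {t : ℕ} {f : Finset (Fin n) → N}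
    (hfp : Paper.restr R N p f = f) (hf : EvBoundary y t (i ∘ f)) : EvBoundary y t f := by
  obtain ⟨s, b, hb⟩ := hf
  rw [trans_comp] at hb
  have hb' := congrArg (Paper.restr R P p) hb
  rw [restr_comp, restr_trans, hfp] at hb'
  cases p with
  | zero =>
    rw [restr_koszul_zero] at hb'
    refine ⟨s, 0, ?_⟩
    ext T
    apply hi
    simpa using congrFun hb' T
  | succ q =>
    rw [restr_koszul_succ] at hb'
    set b' := Paper.restr R P q b with hb'_def
    have hcyc : koszul y Q (t + s) (π ∘ b') = 0 := by
      rw [koszul_comp, hb']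
      ext T
      simp [hex.apply_apply_eq_zero]
    obtain ⟨s', c, hc⟩ := hQ q rfl _ _ hcyc
    rw [restr_comp, hb'_def, restr_restr, ← hb'_def, trans_comp] at hc
    have hc' : ∃ c' : Finset (Fin n) → P, π ∘ c' = c :=
      ⟨fun T => (hπ (c T)).choose, funext fun T => (hπ (c T)).choose_spec⟩
    obtain ⟨c, rfl⟩ := hc'
    rw [koszul_comp] at hc
    have ha : ∀ T, ∃ a, i a = (trans y P s' b' - koszul y P (t + s + s') c) T := fun T => by
      refine (hex _).mp ?_
      have := congrFun hc T
      simp only [Function.comp_apply] at this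
      rw [Pi.sub_apply, map_sub, this, sub_self]
    choose a ha using ha
    refine ⟨s + s', a, ?_⟩
    have hia : i ∘ a = trans y P s' b' - koszul y P (t + s + s') c := funext ha
    have : i ∘ koszul y N (t + (s + s')) a = i ∘ trans y N (s + s') f := by
      rw [← koszul_comp, hia, map_sub, ← add_assoc, koszul_koszul, sub_zero, koszul_trans, hb',
        trans_comp, trans_trans]
    ext T
    exact hi (congrFun this T)

lemma CohVanish.of_injective {i : N →ₗ[R] P} {π : P →ₗ[R] Q} (hi : Function.Injective i)
    (hπ : Function.Surjective π) (hex : Function.Exact i π) {p : ℕ}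
    (hQ : ∀ q, q + 1 = p → CohVanish y Q q) (hP : CohVanish y P p) : CohVanish y N p := by
  intro t f hf
  refine EvBoundary.of_comp_injective hi hπ hex hQ (restr_restr p f) ?_
  rw [← restr_comp]
  refine hP t _ ?_
  rw [koszul_comp, hf]
  ext
  simp

lemma CohVanish.of_surjective {i : N →ₗ[R] P} {π : P →ₗ[R] Q} (hi : Function.Injective i)
    (hπ : Function.Surjective π) (hex : Function.Exact i π) {p : ℕ}
    (hP : CohVanish y P p) (hN : CohVanish y N (p + 1)) : CohVanish y Q p := by
  intro t f hf
  obtain ⟨f, rfl⟩ : ∃ f' : Finset (Fin n) → P, π ∘ f' = f :=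
    ⟨fun T => (hπ (f T)).choose, funext fun T => (hπ (f T)).choose_spec⟩
  rw [koszul_comp] at hf
  choose a ha using fun T => (hex _).mp (congrFun hf T)
  have hia : i ∘ a = koszul y P t f := funext ha
  have hacyc : koszul y N t a = 0 := by
    ext T
    apply hi
    have := congrFun (koszul_comp y i t a) T
    rw [hia, koszul_koszul] at this
    simpa using this.symm
  obtain ⟨s, a', ha'⟩ := hN t a hacyc
  have hcyc : koszul y P (t + s) (trans y P s (Paper.restr R P p f) - i ∘ a') = 0 := by
    rw [map_sub, koszul_trans, koszul_comp, ha', ← trans_comp, ← restr_comp, hia,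
      restr_koszul_succ, sub_self]
  have h := (hP _ _ hcyc).comp π
  rw [← restr_comp] at h
  have h0 : π ∘ (trans y P s (Paper.restr R P p f) - i ∘ a') =
      trans y Q s (Paper.restr R Q p (π ∘ f)) := by
    rw [restr_comp, trans_comp]
    ext T
    simp [hex.apply_apply_eq_zero]
  rw [h0, restr_trans, restr_restr] at h
  exact h.of_trans

open scoped Pointwise in
lemma CohVanish.of_isSMulRegular {z : R} (hz : z ∈ Ideal.span (Set.range y))
    (hreg : IsSMulRegular N z) {p : ℕ}
    (hQ : ∀ q, q + 1 = p → CohVanish y (QuotSMulTop z N) q) : CohVanish y N p := by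
  intro t f hf
  have hf' := koszul_restr_eq_zero y hf p
  obtain ⟨k, hk⟩ := exists_pow_evBoundary hf'
  have hzk := hk _ (Ideal.pow_mem_pow hz k)
  clear hk
  have hex : Function.Exact (LinearMap.lsmul R N z) (Submodule.mkQ (z • (⊤ : Submodule R N))) := by
    rw [LinearMap.exact_iff, Submodule.ker_mkQ]
    ext x
    simp [Submodule.mem_smul_pointwise_iff_exists]
  induction k with
  | zero => simpa using hzk
  | succ k ih =>
    refine ih (EvBoundary.of_comp_injective (i := LinearMap.lsmul R N z) hreg
      (Submodule.mkQ_surjective _) hex hQ (p := p) ?_ ?_)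
    · rw [map_smul, restr_restr]
    · convert hzk using 1
      ext T
      simp [smul_smul, pow_succ', mul_comm]

lemma CohVanish.of_isWeaklyRegular {rs : List R} (hrs : ∀ r ∈ rs, r ∈ Ideal.span (Set.range y))
    (hreg : RingTheory.Sequence.IsWeaklyRegular N rs) {p : ℕ} (hp : p < rs.length) :
    CohVanish y N p := by
  induction rs generalizing N p with
  | nil => simp at hp
  | cons r rs ih =>
    rw [RingTheory.Sequence.isWeaklyRegular_cons_iff] at hreg
    refine CohVanish.of_isSMulRegular (hrs r (by simp)) hreg.1 fun q hq => ?_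
    exact ih (fun a ha => hrs a (by simp [ha])) hreg.2 (by simp at hp; omega)

lemma CohVanish.of_quotient {rs : List R} (hrs : ∀ r ∈ rs, r ∈ Ideal.span (Set.range y))
    (hreg : RingTheory.Sequence.IsWeaklyRegular N rs)
    (hQ : ∀ p, p ≠ 0 → CohVanish y (N ⧸ (Ideal.ofList rs • ⊤ : Submodule R N)) p)
    {p : ℕ} (hp : rs.length < p) : CohVanish y N p := by
  induction rs generalizing N p with
  | nil =>
    refine (hQ p (by simp at hp; omega)).of_linearEquiv (Submodule.quotEquivOfEqBot _ ?_)
    simp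
  | cons r rs ih =>
    rw [RingTheory.Sequence.isWeaklyRegular_cons_iff] at hreg
    refine CohVanish.of_isSMulRegular (hrs r (by simp)) hreg.1 fun q hq => ?_
    refine ih (fun a ha => hrs a (by simp [ha])) hreg.2 (fun p hp => ?_) (by simp at hp; omega)
    exact (hQ p hp).of_linearEquiv (Submodule.quotOfListConsSMulTopEquivQuotSMulTopInner N r rs)

/-- Positive cohomology vanishes on Artinian modules. -/
lemma CohVanish.of_isArtinian [IsNoetherianRing R] [Module.Finite R N] [IsArtinian R N] {p : ℕ}
    (hp : p ≠ 0) : CohVanish y N p := by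
  let I := Ideal.span (Set.range y)
  obtain ⟨k, hk⟩ := IsArtinian.monotone_stabilizes (R := R) (M := N)
    ⟨fun k => OrderDual.toDual (I ^ k • (⊤ : Submodule R N)), fun a b hab =>
      Submodule.smul_mono_left (Ideal.pow_le_pow_right hab)⟩
  have hk1 : I ^ k • (⊤ : Submodule R N) = I • (I ^ k • (⊤ : Submodule R N)) := by
    rw [← Submodule.mul_smul, ← pow_succ']
    exact hk (k + 1) (Nat.le_succ k)
  obtain ⟨r, hr, hr0⟩ := Submodule.exists_sub_one_mem_and_smul_eq_zero_of_fg_of_le_smul I _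
    (IsNoetherian.noetherian _) hk1.le
  intro t f hf
  obtain ⟨m, hm⟩ := exists_pow_evBoundary (koszul_restr_eq_zero y hf p)
  have hrf : EvBoundary y t (r • Paper.restr R N p f) := by
    refine ⟨k, 0, ?_⟩
    rw [map_smul, map_zero]
    ext T
    rw [Pi.smul_apply, trans_apply, restr_apply]
    split_ifs with h
    · refine (hr0 _ (Submodule.smul_mem_smul (Ideal.pow_mem_pow ?_ k) trivial)).symm
      obtain ⟨j, hj⟩ := Finset.card_pos.mp (by omega : 0 < T.card)
      exact Ideal.mem_of_dvd _ (Finset.dvd_prod_of_mem y hj) (Ideal.subset_span ⟨j, rfl⟩)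
    · simp
  have hmem : (1 - r) ^ m ∈ I ^ m :=
    Ideal.pow_mem_pow (by rw [← neg_sub]; exact I.neg_mem hr) m
  obtain ⟨c, hc⟩ : ∃ c, (1 : R) = (1 - r) ^ m + c * r := by
    obtain ⟨c, hc⟩ := sub_dvd_pow_sub_pow (1 : R) (1 - r) m
    refine ⟨c, ?_⟩
    rw [one_pow] at hc
    linear_combination hc
  rw [← one_smul R (Paper.restr R N p f), hc, add_smul, mul_smul]
  exact (hm _ hmem).add (hrf.smul c)

/-- Vanishing above `d` for the ring implies vanishing above `d` for finite modules. -/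
lemma CohVanish.of_finite [IsNoetherianRing R] {d : ℕ} (hR : ∀ p, d < p → CohVanish y R p)
    [Module.Finite R N] {p : ℕ} (hp : d < p) : CohVanish y N p := by
  obtain ⟨k, hk⟩ : ∃ k, n < p + k := ⟨n + 1, by omega⟩
  induction k generalizing N p with
  | zero => exact CohVanish.of_lt hk
  | succ k ih =>
    obtain ⟨m, π, hπ⟩ := Module.Finite.exists_fin' R N
    exact CohVanish.of_surjective (LinearMap.ker π).injective_subtype hπ
      (LinearMap.exact_subtype_ker_map π) (hR p hp).pi (ih (by omega) (by omega))

end Cohomology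

section CohenMacaulay

variable {n : ℕ} {y : Fin n → R}

lemma supportDim_quotient_add_length_le [IsNoetherianRing R] {rs : List R} {N : Type}
    [AddCommGroup N] [Module R N] [Module.Finite R N]
    (hreg : RingTheory.Sequence.IsWeaklyRegular N rs) :
    Module.supportDim R (N ⧸ (Ideal.ofList rs • ⊤ : Submodule R N)) + rs.length ≤
      Module.supportDim R N := by
  induction rs generalizing N with
  | nil =>
    rw [Ideal.ofList_nil, Submodule.bot_smul]
    simpa using (Module.supportDim_eq_of_equiv (Submodule.quotEquivOfEqBot ⊥ rfl)).le
  | cons r rs ih =>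
    rw [RingTheory.Sequence.isWeaklyRegular_cons_iff] at hreg
    rw [Module.supportDim_eq_of_equiv
      (Submodule.quotOfListConsSMulTopEquivQuotSMulTopInner N r rs), List.length_cons,
      Nat.cast_add, ← add_assoc]
    exact (add_le_add_left (ih hreg.2) 1).trans
      (Module.supportDim_quotSMulTop_succ_le_of_notMem_minimalPrimes
        fun _ => hreg.1.notMem_of_mem_minimalPrimes)

lemma nonpos_of_add_natCast_le {a : WithBot ℕ∞} {d : ℕ} (h : a + d ≤ d) : a ≤ 0 := by
  induction a with
  | bot => exact bot_le
  | coe a =>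
    have h' : a + d ≤ d := WithBot.coe_le_coe.mp h
    exact WithBot.coe_le_coe.mpr 
      ((ENat.add_le_add_iff_right (ENat.natCast_ne_top d)).mp (by simpa using h'))

/-- The cohomology of a Cohen–Macaulay ring of dimension `d` is concentrated in degree `d`. -/
lemma cohVanish_of_depthGE [IsNoetherianRing R] {d : ℕ}
    (hdim : ringKrullDim R = (d : WithBot (WithTop ℕ)))
    (hCM : depthGE (Ideal.span (Set.range y)) R d) {p : ℕ} (hp : p ≠ d) : CohVanish y R p := by
  obtain hR | ⟨rs, hlen, hrs, hreg⟩ := hCM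
  · exact CohVanish.of_subsingleton p
  rcases lt_or_gt_of_ne hp with hp | hp
  · exact CohVanish.of_isWeaklyRegular hrs hreg.toIsWeaklyRegular (hlen ▸ hp)
  refine CohVanish.of_quotient hrs hreg.toIsWeaklyRegular (fun q hq => ?_) (hlen ▸ hp)
  have h := supportDim_quotient_add_length_le hreg.toIsWeaklyRegular
  rw [Module.supportDim_self_eq_ringKrullDim, hdim, hlen] at h
  have h0 : ringKrullDim (R ⧸ (Ideal.ofList rs • ⊤ : Ideal R)) ≤ 0 := by
    rw [← Module.supportDim_quotient_eq_ringKrullDim]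
    exact nonpos_of_add_natCast_le h
  have hart : IsArtinianRing (R ⧸ (Ideal.ofList rs • ⊤ : Ideal R)) :=
    isArtinianRing_iff_krullDimLE_zero.mpr (Ring.krullDimLE_iff.mpr h0)
  have : IsArtinian R (R ⧸ (Ideal.ofList rs • ⊤ : Ideal R)) :=
    isArtinian_of_surjective_algebraMap (R := R ⧸ (Ideal.ofList rs • ⊤ : Ideal R))
      Ideal.Quotient.mk_surjective
  exact CohVanish.of_isArtinian hq

end CohenMacaulay

section Homogeneous

variable {n : ℕ} {y : Fin n → R} {N : Type} [AddCommGroup N] [Module R N]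

/-- `pr` is the family of projections onto the pieces `𝒩 k` of a grading in which each `y j` is
homogeneous of degree `e j`. -/
structure HomProj (y : Fin n → R) (e : Fin n → ℤ) (𝒩 : ℤ → AddSubgroup N)
    (pr : ℤ → N →+ N) : Prop where
  mem : ∀ k x, pr k x ∈ 𝒩 k
  eq : ∀ k, ∀ x ∈ 𝒩 k, pr k x = x
  map_smul : ∀ j k x, pr (k + e j) (y j • x) = y j • pr k x

variable {e : Fin n → ℤ} {𝒩 : ℤ → AddSubgroup N} {pr : ℤ → N →+ N}

/-- Homogeneity of degree `ℓ` of a cochain of the Koszul complex of `yᵗ`. -/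
def IsHomog (𝒩 : ℤ → AddSubgroup N) (e : Fin n → ℤ) (t : ℕ) (ℓ : ℤ)
    (f : Finset (Fin n) → N) : Prop :=
  ∀ T, f T ∈ 𝒩 (ℓ + (t : ℤ) * ∑ j ∈ T, e j)

lemma ksign_smul_mem (𝒩 : AddSubgroup N) {x : N} (hx : x ∈ 𝒩) (T : Finset (Fin n)) (j : Fin n) :
    ksign R T j • x ∈ 𝒩 := by
  unfold ksign
  rcases neg_one_pow_eq_or R (T.filter (fun a => a < j)).card with h | h <;> simpa [h] using hx

lemma map_ksign_smul (φ : N →+ N) (x : N) (T : Finset (Fin n)) (j : Fin n) :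
    φ (ksign R T j • x) = ksign R T j • φ x := by
  unfold ksign
  rcases neg_one_pow_eq_or R (T.filter (fun a => a < j)).card with h | h <;> simp [h]

namespace HomProj

lemma smul_mem (h : HomProj y e 𝒩 pr) {j : Fin n} {k : ℤ} {x : N} (hx : x ∈ 𝒩 k) :
    y j • x ∈ 𝒩 (k + e j) := by
  have := h.mem (k + e j) (y j • x)
  rwa [h.map_smul, h.eq k x hx] at this

lemma map_pow_smul (h : HomProj y e 𝒩 pr) (j : Fin n) (t : ℕ) (k : ℤ) (x : N) :
    pr (k + t * e j) (y j ^ t • x) = y j ^ t • pr k x := by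
  induction t with
  | zero => simp
  | succ t ih =>
    have : k + ((t + 1 : ℕ) : ℤ) * e j = k + t * e j + e j := by push_cast; ring
    rw [this, pow_succ', mul_smul, h.map_smul, ih, mul_smul]

lemma pow_smul_mem (h : HomProj y e 𝒩 pr) (j : Fin n) (t : ℕ) {k : ℤ} {x : N} (hx : x ∈ 𝒩 k) :
    y j ^ t • x ∈ 𝒩 (k + t * e j) := by
  have := h.mem (k + t * e j) (y j ^ t • x)
  rwa [h.map_pow_smul, h.eq k x hx] at this

lemma prod_pow_smul_mem (h : HomProj y e 𝒩 pr) (T : Finset (Fin n)) (t : ℕ) {k : ℤ} {x : N}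
    (hx : x ∈ 𝒩 k) : (∏ j ∈ T, y j) ^ t • x ∈ 𝒩 (k + t * ∑ j ∈ T, e j) := by
  induction T using Finset.induction_on with
  | empty => simpa using hx
  | insert j T hj ih =>
    rw [Finset.prod_insert hj, Finset.sum_insert hj, mul_pow, mul_smul]
    have := h.pow_smul_mem j t ih
    convert this using 2
    ring

lemma isHomog_trans (h : HomProj y e 𝒩 pr) {t s : ℕ} {ℓ : ℤ} {f : Finset (Fin n) → N}
    (hf : IsHomog 𝒩 e t ℓ f) : IsHomog 𝒩 e (t + s) ℓ (trans y N s f) := fun T => by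
  have := h.prod_pow_smul_mem T s (hf T)
  rw [trans_apply]
  convert this using 2
  push_cast
  ring

/-- A homogeneous coboundary of degree `p` has a homogeneous primitive of degree `p - 1`. -/
lemma exists_homog_primitive (h : HomProj y e 𝒩 pr) {t p : ℕ} {ℓ : ℤ}
    {f g : Finset (Fin n) → N} (hg : koszul y N t g = f) (hf : IsHomog 𝒩 e t ℓ f)
    (hfp : restr R N p f = f) :
    ∃ g', koszul y N t g' = f ∧ (∀ T : Finset (Fin n), T.card + 1 ≠ p → g' T = 0) ∧
      IsHomog 𝒩 e t ℓ g' := by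
  refine ⟨fun T => if T.card + 1 = p then pr (ℓ + (t : ℤ) * ∑ j ∈ T, e j) (g T) else 0, ?_,
    fun T hT => if_neg hT, fun T => ?_⟩
  · ext T
    rw [koszul_apply]
    by_cases hT : T.card = p
    · rw [← h.eq _ _ (hf T), ← hg, koszul_apply, map_sum]
      refine Finset.sum_congr rfl fun j hj => ?_
      rw [if_pos (by rw [Finset.card_erase_add_one hj, hT]), mul_smul, mul_smul, map_ksign_smul,
        ← h.map_pow_smul, ← Finset.add_sum_erase T e hj]
      congr 3
      ring
    · rw [← hfp, restr_apply, if_neg hT]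
      refine Finset.sum_eq_zero fun j hj => ?_
      rw [if_neg (by rw [Finset.card_erase_add_one hj]; exact hT), smul_zero]
  · dsimp only
    split_ifs
    · exact h.mem _ _
    · exact zero_mem _

end HomProj

/-- The Koszul boundary on families of cochains indexed by finite sets. -/
def bdry (y : Fin n → R) (u : Finset (Fin n) → Finset (Fin n) → N) (S : Finset (Fin n)) :
    Finset (Fin n) → N :=
  ∑ j ∈ Sᶜ, (ksign R (insert j S) j * y j) • u (insert j S)

lemma koszul_one_single (S : Finset (Fin n)) (x : N) :
    koszul y N 1 (Pi.single S x) = bdry y (fun S => Pi.single S x) S := by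
  ext T
  simp only [koszul_apply, bdry, Finset.sum_apply, Pi.smul_apply, pow_one, Pi.single_apply,
    smul_ite, smul_zero]
  rw [← Finset.sum_filter, ← Finset.sum_filter]
  refine Finset.sum_congr ?_ ?_
  · ext j
    simp only [Finset.mem_filter, Finset.mem_compl]
    constructor
    · rintro ⟨hj, rfl⟩
      simp [Finset.insert_erase hj]
    · rintro ⟨hj, rfl⟩
      simp [Finset.erase_insert hj]
  · intro j hj
    rw [(Finset.mem_filter.mp hj).2]

lemma bdry_bdry (u : Finset (Fin n) → Finset (Fin n) → N) (S : Finset (Fin n)) :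
    bdry y (bdry y u) S = 0 := by
  unfold bdry
  simp only [Finset.smul_sum, smul_smul]
  have hc : ∀ j, (insert j S)ᶜ = Sᶜ.erase j := fun j => by
    ext l
    simp
  simp only [hc]
  refine sum_sum_erase_eq_zero Sᶜ _ fun j hj l hl hjl => ?_
  rw [Finset.insert_comm l j, ← neg_smul]
  congr 1
  rw [Finset.mem_compl] at hj hl
  have h := ksign_anticomm (R := R) (T := insert j (insert l S)) (i := j) (j := l) (by simp)
    (by simp) hjl
  rw [Finset.erase_insert (by simp [hjl, hj]), Finset.insert_comm,
    Finset.erase_insert (by simp [hjl.symm, hl]), Finset.insert_comm] at h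
  linear_combination (y j * y l) * h

/-- If all cohomology of `N` vanishes except in degree `d`, and the degree `d` cohomology vanishes
in internal degrees larger than `L`, then homogeneous elements of sufficiently large degree lie
in the submodule generated by the multiples of `y`. -/
lemma exists_eq_sum_smul (h : HomProj y e 𝒩 pr) {d : ℕ} {L k : ℤ}
    (hV : ∀ p, p ≠ d → CohVanish y N p)
    (hd : ∀ ℓ, L < ℓ → ∀ (t : ℕ) (f : Finset (Fin n) → N), koszul y N t f = 0 →
      restr R N d f = f → IsHomog 𝒩 e t ℓ f → EvBoundary y t f)
    (hk : ∀ S : Finset (Fin n), S.card = d → L < k - ∑ j ∈ S, e j) {x : N} (hx : x ∈ 𝒩 k) :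
    ∃ c : Fin n → N, x = ∑ j, y j • c j := by
  have key : ∀ q p : ℕ, n < p + q → ∃ (t : ℕ) (u : Finset (Fin n) → Finset (Fin n) → N),
      ∀ S : Finset (Fin n), p ≤ S.card →
        koszul y N (1 + t) (u S) = trans y N t (Pi.single S x) - bdry y u S ∧
        (∀ T : Finset (Fin n), T.card + 1 ≠ S.card → u S T = 0) ∧
        IsHomog 𝒩 e (1 + t) (k - ∑ j ∈ S, e j) (u S) := by
    intro q
    induction q with
    | zero =>
      intro p hp
      refine ⟨0, 0, fun S hS => ?_⟩
      have := card_finset_fin_le S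
      omega
    | succ q ih =>
      intro p hp
      obtain ⟨t, u, hu⟩ := ih (p + 1) (by omega)
      set c : Finset (Fin n) → Finset (Fin n) → N :=
        fun S => trans y N t (Pi.single S x) - bdry y u S with hc
      have hcins : ∀ S : Finset (Fin n), S.card = p → ∀ j ∈ Sᶜ, p + 1 ≤ (insert j S).card := by
        intro S hS j hj
        rw [Finset.card_insert_of_notMem (Finset.mem_compl.mp hj), hS]
      have hcyc : ∀ S : Finset (Fin n), S.card = p → koszul y N (1 + t) (c S) = 0 := by
        intro S hS
        have hb : koszul y N (1 + t) (bdry y u S) =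
            bdry y (fun S => trans y N t (Pi.single S x) - bdry y u S) S := by
          simp only [bdry, map_sum, map_smul]
          exact Finset.sum_congr rfl fun j hj => by rw [(hu _ (hcins S hS j hj)).1, bdry]
        have hb' : bdry y (fun S => trans y N t (Pi.single S x) - bdry y u S) S =
            trans y N t (bdry y (fun S => Pi.single S x) S) - bdry y (bdry y u) S := by
          conv_lhs => unfold bdry
          simp only [smul_sub, Finset.sum_sub_distrib]
          congr 1
          simp only [bdry, map_sum, map_smul]
        rw [hc, map_sub, koszul_trans, koszul_one_single, hb, hb', bdry_bdry, sub_zero, sub_self]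
      have hconc : ∀ S : Finset (Fin n), S.card = p → restr R N p (c S) = c S := by
        intro S hS
        ext T
        rw [restr_apply]
        split_ifs with hT
        · rfl
        · have hne : T ≠ S := fun h => hT (h ▸ hS)
          simp only [hc, bdry, Pi.sub_apply, trans_apply, Pi.single_apply, if_neg hne, smul_zero,
            zero_sub, Finset.sum_apply, Pi.smul_apply]
          rw [Finset.sum_eq_zero, neg_zero]
          intro j hj
          rw [(hu _ (hcins S hS j hj)).2.1, smul_zero]
          rw [Finset.card_insert_of_notMem (Finset.mem_compl.mp hj)]
          omega
      have hhom : ∀ S : Finset (Fin n), S.card = p →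
          IsHomog 𝒩 e (1 + t) (k - ∑ j ∈ S, e j) (c S) := by
        intro S hS T
        refine sub_mem ?_ ?_
        · rw [trans_apply, Pi.single_apply]
          split_ifs with hT
          · subst hT
            convert h.prod_pow_smul_mem T t hx using 2
            push_cast
            ring
          · simp [zero_mem]
        · rw [bdry, Finset.sum_apply]
          refine sum_mem fun j hj => ?_
          rw [Pi.smul_apply, mul_smul]
          refine ksign_smul_mem _ ?_ _ _
          convert h.smul_mem (j := j) ((hu _ (hcins S hS j hj)).2.2 T) using 2
          rw [Finset.sum_insert (Finset.mem_compl.mp hj)]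
          ring
      have hev : ∀ S : Finset (Fin n), ∃ s : ℕ, S.card = p →
          ∃ g, koszul y N (1 + t + s) g = trans y N s (c S) := by
        intro S
        by_cases hS : S.card = p
        · have : EvBoundary y (1 + t) (c S) := by
            by_cases hpd : p = d
            · exact hd _ (hk S (hS.trans hpd)) _ _ (hcyc S hS) (hpd ▸ hconc S hS) (hhom S hS)
            · rw [← hconc S hS]
              exact hV p hpd _ _ (hcyc S hS)
          obtain ⟨s, g, hg⟩ := this
          exact ⟨s, fun _ => ⟨g, hg⟩⟩
        · exact ⟨0, fun h => absurd h hS⟩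
      choose s hs using hev
      have hprim : ∀ S : Finset (Fin n), ∃ g, S.card = p →
          koszul y N (1 + t + Finset.univ.sup s) g = trans y N (Finset.univ.sup s) (c S) ∧
          (∀ T : Finset (Fin n), T.card + 1 ≠ p → g T = 0) ∧
          IsHomog 𝒩 e (1 + t + Finset.univ.sup s) (k - ∑ j ∈ S, e j) g := by
        intro S
        by_cases hS : S.card = p
        · obtain ⟨g, hg⟩ := hs S hS
          obtain ⟨g', hg'⟩ := exists_boundary_of_le (Finset.le_sup (Finset.mem_univ S)) hg
          obtain ⟨g'', hg''⟩ := h.exists_homog_primitive hg' (h.isHomog_trans (hhom S hS))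
            (p := p) (by rw [restr_trans, hconc S hS])
          exact ⟨g'', fun _ => hg''⟩
        · exact ⟨0, fun h => absurd h hS⟩
      choose g hg using hprim
      generalize Finset.univ.sup s = s₀ at hg
      refine ⟨t + s₀, fun S => if S.card = p then g S else trans y N s₀ (u S), fun S hS => ?_⟩
      have hbd : bdry y (fun S => if S.card = p then g S else trans y N s₀ (u S)) S =
          trans y N s₀ (bdry y u S) := by
        simp only [bdry, map_sum, map_smul]
        refine Finset.sum_congr rfl fun j hj => ?_
        rw [if_neg]
        rw [Finset.card_insert_of_notMem (Finset.mem_compl.mp hj)]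
        omega
      rw [hbd, ← add_assoc, ← trans_trans, ← map_sub]
      by_cases hSp : S.card = p
      · simp only [hSp]
        exact hg S hSp
      · obtain ⟨h1, h2, h3⟩ := hu S (by omega)
        simp only [if_neg hSp]
        refine ⟨by rw [koszul_trans, h1], fun T hT => ?_, h.isHomog_trans h3⟩
        rw [trans_apply, h2 T hT, smul_zero]
  obtain ⟨t, u, hu⟩ := key (n + 1) 0 (by omega)
  have h0 := congrFun (hu ∅ (by simp)).1 ∅
  simp only [koszul_apply, Finset.sum_empty, Pi.sub_apply, trans_apply, Finset.prod_empty, one_pow,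
    one_smul, Pi.single_eq_same, bdry, Finset.sum_apply, Finset.compl_empty, Pi.smul_apply] at h0
  refine ⟨fun j => ksign R (insert j ∅) j • u (insert j ∅) ∅, ?_⟩
  rw [sub_eq_zero.mp h0.symm]
  exact Finset.sum_congr rfl fun j _ => by rw [smul_smul, mul_comm]

end Homogeneous

section Conversion

variable {n : ℕ} {y : Fin n → R} {e : Fin n → ℤ}

lemma KVanish.evBoundary {𝒩 : ℤ → AddSubgroup R} {d : ℕ} {ℓ : ℤ} (hK : KVanish y 𝒩 e d ℓ) {t : ℕ}
    {f : Finset (Fin n) → R} (hf : koszul y R t f = 0) (hfd : restr R R d f = f)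
    (hfh : IsHomog 𝒩 e t ℓ f) : EvBoundary y t f := by
  have hsupp : ∀ T : Finset (Fin n), T.card ≠ d → f T = 0 := fun T hT => by
    rw [← hfd, restr_apply, if_neg hT]
  obtain ⟨s, hs⟩ := hK t (fun S => f S.1) (by
    ext T
    refine Eq.trans ?_ (congrFun hf T.1)
    rw [koszul_apply, ← Finset.sum_attach]
    refine Finset.sum_congr rfl fun j _ => ?_
    rw [mul_smul, ksign, ← Int.cast_smul_eq_zsmul R]
    simp) fun S => hfh S.1
  cases d with
  | zero =>
    refine ⟨s, 0, ?_⟩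
    ext T
    rw [map_zero, trans_apply]
    by_cases hT : T.card = 0
    · exact (congrFun hs ⟨T, hT⟩).symm
    · rw [hsupp T hT, smul_zero]; rfl
  | succ d =>
    obtain ⟨g, hg⟩ := hs
    refine ⟨s, fun T => if h : T.card = d then g ⟨T, h⟩ else 0, ?_⟩
    ext T
    rw [koszul_apply, trans_apply]
    by_cases hT : T.card = d + 1
    · refine Eq.trans ?_ (congrFun hg ⟨T, hT⟩)
      rw [← Finset.sum_attach]
      refine Finset.sum_congr rfl fun j _ => ?_
      rw [mul_smul, ksign, ← Int.cast_smul_eq_zsmul R, dif_pos]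
      · simp
      · rw [Finset.card_erase_of_mem j.2, hT]; rfl
    · rw [hsupp T hT, smul_zero]
      refine Finset.sum_eq_zero fun j hj => ?_
      rw [dif_neg, smul_zero]
      have := Finset.card_erase_add_one hj
      omega

lemma sum_le_sum_filter_lt (he : ∀ j k : Fin n, j ≤ k → e k ≤ e j) {d : ℕ}
    {S : Finset (Fin n)} (hS : S.card = d) :
    ∑ j ∈ S, e j ≤ ∑ j ∈ Finset.univ.filter (fun j : Fin n => (j : ℕ) < d), e j := by
  have hd : d ≤ n := by simpa [hS] using S.card_le_univ
  have h1 : ∑ j ∈ S, e j = ∑ i : Fin d, e (S.orderEmbOfFin hS i) := by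
    conv_lhs => rw [← Finset.image_orderEmbOfFin_univ S hS]
    exact Finset.sum_image fun _ _ _ _ h => (S.orderEmbOfFin hS).injective h
  have h2 : ∑ j ∈ Finset.univ.filter (fun j : Fin n => (j : ℕ) < d), e j =
      ∑ i : Fin d, e (Fin.castLE hd i) := by
    rw [← Finset.sum_image (s := Finset.univ) (g := Fin.castLE hd) (f := e)
      fun _ _ _ _ h => Fin.castLE_injective hd h]
    refine Finset.sum_congr ?_ fun _ _ => rfl
    ext j
    simp only [Finset.mem_filter, Finset.mem_univ, true_and, Finset.mem_image]
    exact ⟨fun h => ⟨⟨j, h⟩, rfl⟩, by rintro ⟨i, rfl⟩; exact i.2⟩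
  rw [h1, h2]
  refine Finset.sum_le_sum fun i _ => he _ _ ?_
  have key : ∀ m (hm : m < d), m ≤ (S.orderEmbOfFin hS ⟨m, hm⟩ : ℕ) := by
    intro m
    induction m with
    | zero => exact fun _ => Nat.zero_le _
    | succ m ih =>
      intro hm
      have h := ih (by omega)
      have h' : S.orderEmbOfFin hS ⟨m, by omega⟩ < S.orderEmbOfFin hS ⟨m + 1, hm⟩ :=
        (S.orderEmbOfFin hS).strictMono (Fin.mk_lt_mk.mpr (Nat.lt_succ_self m))
      exact Nat.succ_le_of_lt (h.trans_lt h')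
  exact key i i.2

end Conversion

section Graded

variable {M : Type} [AddCommGroup M] [Module R M]

/-- The projection of a graded module onto its piece of degree `k`. -/
def proj (ℳ : ℤ → AddSubgroup M) [DirectSum.Decomposition ℳ] (k : ℤ) : M →+ M where
  toFun x := DirectSum.decompose ℳ x k
  map_zero' := by simp
  map_add' x x' := by simp

variable {𝒜 : ℤ → AddSubgroup R} {ℳ : ℤ → AddSubgroup M}

lemma smul_mem_graded [SetLike.GradedSMul 𝒜 ℳ] {i k : ℤ} {r : R} {x : M} (hr : r ∈ 𝒜 i)
    (hx : x ∈ ℳ k) : r • x ∈ ℳ (k + i) := by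
  rw [add_comm, ← vadd_eq_add]
  exact SetLike.GradedSMul.smul_mem hr hx

variable [DirectSum.Decomposition ℳ]

lemma proj_apply (k : ℤ) (x : M) : proj ℳ k x = DirectSum.decompose ℳ x k := rfl

lemma proj_mem (k : ℤ) (x : M) : proj ℳ k x ∈ ℳ k := (DirectSum.decompose ℳ x k).2

lemma proj_of_mem {k : ℤ} {x : M} (hx : x ∈ ℳ k) : proj ℳ k x = x :=
  DirectSum.decompose_of_mem_same ℳ hx

lemma proj_of_mem_ne {k l : ℤ} {x : M} (hx : x ∈ ℳ k) (hkl : k ≠ l) : proj ℳ l x = 0 :=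
  DirectSum.decompose_of_mem_ne ℳ hx hkl

lemma mem_of_proj_mem {N : Submodule R M} {x : M} (hx : ∀ k, proj ℳ k x ∈ N) : x ∈ N := by
  classical
  rw [← DirectSum.sum_support_decompose ℳ x]
  exact sum_mem fun k _ => hx k

lemma proj_add_smul [SetLike.GradedSMul 𝒜 ℳ] {i : ℤ} {r : R} (hr : r ∈ 𝒜 i) (k : ℤ) (x : M) :
    proj ℳ (k + i) (r • x) = r • proj ℳ k x := by
  induction x using DirectSum.Decomposition.inductionOn ℳ with
  | zero => simp
  | @homogeneous l x =>
    by_cases h : l = k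
    · subst h
      rw [proj_of_mem (smul_mem_graded hr x.2), proj_of_mem x.2]
    · rw [proj_of_mem_ne (smul_mem_graded hr x.2) (by simpa using h), proj_of_mem_ne x.2 h,
        smul_zero]
  | add x x' h h' => rw [smul_add, map_add, map_add, h, h', smul_add]

lemma proj_smul_of_mem [GradedRing 𝒜] [SetLike.GradedSMul 𝒜 ℳ] {i : ℤ} {x : M} (hx : x ∈ ℳ i)
    (k : ℤ) (r : R) : proj ℳ k (r • x) = proj 𝒜 (k - i) r • x := by
  induction r using DirectSum.Decomposition.inductionOn 𝒜 with
  | zero => simp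
  | @homogeneous l r =>
    by_cases h : i + l = k
    · subst h
      rw [proj_of_mem (smul_mem_graded r.2 hx), add_sub_cancel_left, proj_of_mem r.2]
    · rw [proj_of_mem_ne (smul_mem_graded r.2 hx) h, proj_of_mem_ne r.2 (by omega), zero_smul]
  | add r r' h h' => rw [add_smul, map_add, map_add, h, h', add_smul]

lemma proj_mem_span [GradedRing 𝒜] [SetLike.GradedSMul 𝒜 ℳ] {s : Set M}
    (hs : ∀ x ∈ s, ∃ i, x ∈ ℳ i) {x : M} (hx : x ∈ Submodule.span R s) (k : ℤ) :
    proj ℳ k x ∈ Submodule.span R s := by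
  obtain ⟨m, c, g, rfl⟩ := Submodule.mem_span_set'.mp hx
  rw [map_sum]
  refine sum_mem fun l _ => ?_
  obtain ⟨i, hi⟩ := hs _ (g l).2
  rw [proj_smul_of_mem (𝒜 := 𝒜) hi]
  exact Submodule.smul_mem _ _ (Submodule.subset_span (g l).2)

lemma mem_torsionSubmodule_of_pow_smul_eq_zero {n : ℕ} {y : Fin n → R} {x : M}
    (h : ∀ j, ∃ t : ℕ, y j ^ t • x = 0) :
    x ∈ torsionSubmodule (Ideal.span (Set.range y)) M := by
  let J : Ideal R := LinearMap.ker (LinearMap.toSpanSingleton R M x)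
  have hle : Ideal.span (Set.range y) ≤ J.radical := by
    rw [Ideal.span_le]
    rintro _ ⟨j, rfl⟩
    obtain ⟨t, ht⟩ := h j
    exact ⟨t, by simpa [J] using ht⟩
  obtain ⟨t, ht⟩ := Ideal.exists_pow_le_of_le_radical_of_fg hle
    (Submodule.fg_span (Set.finite_range y))
  exact ⟨t, fun r hr => by simpa [J] using ht hr⟩

lemma proj_mem_torsionSubmodule [GradedRing 𝒜] [SetLike.GradedSMul 𝒜 ℳ] {n : ℕ} {y : Fin n → R}
    {e : Fin n → ℤ} (hy : ∀ j, y j ∈ 𝒜 (e j)) {x : M}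
    (hx : x ∈ torsionSubmodule (Ideal.span (Set.range y)) M) (k : ℤ) :
    proj ℳ k x ∈ torsionSubmodule (Ideal.span (Set.range y)) M := by
  obtain ⟨t, ht⟩ := hx
  refine mem_torsionSubmodule_of_pow_smul_eq_zero fun j => ⟨t, ?_⟩
  rw [← proj_add_smul (SetLike.pow_mem_graded t (hy j)),
    ht _ (Ideal.pow_mem_pow (Ideal.subset_span (Set.mem_range_self j)) t), map_zero]

lemma not_isUnit_decompose_zero [GradedRing 𝒜] [IsLocalRing (𝒜 0)]
    (hnonneg : ∀ i : ℤ, i < 0 → 𝒜 i = ⊥) {r : R} (hr : r ∈ maxHomIdeal 𝒜) :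
    ¬ IsUnit (DirectSum.decompose 𝒜 r 0) := by
  suffices DirectSum.decompose 𝒜 r 0 ∈ IsLocalRing.maximalIdeal (𝒜 0) by simpa using this
  obtain ⟨m, c, g, rfl⟩ := Submodule.mem_span_set'.mp hr
  rw [DirectSum.decompose_sum, DFinsupp.finsetSum_apply]
  refine sum_mem fun l _ => ?_
  obtain ⟨s, hs⟩ := g l
  simp only [Set.mem_union, Set.mem_ofPred_eq, Set.mem_iUnion] at hs
  rcases hs with ⟨h0, hu⟩ | ⟨i, hi, hsi⟩
  · have : DirectSum.decompose 𝒜 (c l • s) 0 = DirectSum.decompose 𝒜 (c l) 0 * ⟨s, h0⟩ := by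
      apply Subtype.ext
      simpa [proj_apply] using proj_smul_of_mem (𝒜 := 𝒜) h0 0 (c l)
    rw [this]
    exact Ideal.mul_mem_left _ _ (by simpa using hu)
  · have : DirectSum.decompose 𝒜 (c l • s) 0 = 0 := by
      apply Subtype.ext
      refine (proj_smul_of_mem (𝒜 := 𝒜) hsi 0 (c l)).trans ?_
      rcases lt_or_gt_of_ne hi with hi | hi
      · rw [hnonneg i hi] at hsi
        rw [show s = 0 from hsi, smul_zero, ZeroMemClass.coe_zero]
      · have := proj_mem (ℳ := 𝒜) (0 - i) (c l)
        rw [hnonneg _ (by omega), AddSubgroup.mem_bot] at this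
        rw [this, zero_smul, ZeroMemClass.coe_zero]
    rw [this]
    exact zero_mem _

/-- Graded Nakayama lemma: a graded submodule is generated in degrees at most `B` if its
homogeneous elements of larger degree lie in `𝔪 • T`. -/
lemma subGenDegLE_of_mem_smul [GradedRing 𝒜] [SetLike.GradedSMul 𝒜 ℳ] (hloc : IsLocalRing (𝒜 0))
    (hnonneg : ∀ i : ℤ, i < 0 → 𝒜 i = ⊥) {T : Submodule R M} (hfg : T.FG)
    (hT : ∀ x ∈ T, ∀ k, proj ℳ k x ∈ T) {B : ℤ}
    (h : ∀ k, B < k → ∀ x ∈ T, x ∈ ℳ k → x ∈ maxHomIdeal 𝒜 • T) :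
    SubGenDegLE (R := R) ℳ T B := by
  unfold SubGenDegLE
  set L := Submodule.span R (⋃ (j : ℤ) (_ : j ≤ B), ((T : Set M) ∩ (ℳ j : Set M))) with hL
  have hle : T ≤ L ⊔ maxHomIdeal 𝒜 • T := fun x hx => mem_of_proj_mem (ℳ := ℳ) fun k => by
    by_cases hk : k ≤ B
    · refine Submodule.mem_sup_left (Submodule.subset_span ?_)
      simp only [Set.mem_iUnion]
      exact ⟨k, hk, hT x hx k, proj_mem k x⟩
    · exact Submodule.mem_sup_right (h k (by omega) _ (hT x hx k) (proj_mem k x))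
  have hmap : T.map L.mkQ ≤ maxHomIdeal 𝒜 • T.map L.mkQ := by
    refine (Submodule.map_mono hle).trans ?_
    rw [Submodule.map_sup, Submodule.map_smul'', Submodule.mkQ_map_self, bot_sup_eq]
  obtain ⟨r, hr, hrT⟩ := Submodule.exists_sub_one_mem_and_smul_eq_zero_of_fg_of_le_smul _ _
    (hfg.map _) hmap
  have hu : IsUnit (DirectSum.decompose 𝒜 r 0) := by
    have h1 := not_isUnit_decompose_zero hnonneg (neg_mem hr)
    have h2 : DirectSum.decompose 𝒜 (-(r - 1)) 0 = 1 - DirectSum.decompose 𝒜 r 0 := by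
      apply Subtype.ext
      change proj 𝒜 0 (-(r - 1)) = 1 - proj 𝒜 0 r
      rw [neg_sub, map_sub, proj_of_mem (SetLike.one_mem_graded 𝒜)]
    rw [h2] at h1
    simpa using IsLocalRing.isUnit_one_sub_self_of_mem_nonunits _ h1
  refine fun x hx => mem_of_proj_mem (ℳ := ℳ) fun k => ?_
  have hrx : r • proj ℳ k x ∈ L := by
    rw [← Submodule.Quotient.mk_eq_zero, Submodule.Quotient.mk_smul]
    exact hrT _ (Submodule.mem_map_of_mem (hT x hx k))
  have hrx' := proj_mem_span (𝒜 := 𝒜) (ℳ := ℳ) (fun z hz => by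
    simp only [Set.mem_iUnion] at hz
    obtain ⟨j, _, _, hz⟩ := hz
    exact ⟨j, hz⟩) hrx k
  rw [proj_smul_of_mem (𝒜 := 𝒜) (proj_mem k x), sub_self, proj_apply] at hrx'
  obtain ⟨v, hv⟩ := hu.exists_left_inv
  have := L.smul_mem (v : R) hrx'
  rwa [smul_smul, ← SetLike.GradeZero.coe_mul, hv, SetLike.GradeZero.coe_one, one_smul] at this

end Graded

section FreeCover

variable {M : Type} [AddCommGroup M] [Module R M]

lemma GenDegLE.exists_generators [Module.Finite R M] {ℳ : ℤ → AddSubgroup M} {β : ℤ}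
    (h : GenDegLE (R := R) ℳ β) : ∃ (m : ℕ) (g : Fin m → M) (b : Fin m → ℤ),
      (∀ i, g i ∈ ℳ (b i) ∧ b i ≤ β) ∧ Submodule.span R (Set.range g) = ⊤ := by
  have hfg : (⊤ : Submodule R M).FG := Module.Finite.fg_top
  rw [← h, Submodule.fg_span_iff_fg_span_finset_subset] at hfg
  obtain ⟨s, hs, hspan⟩ := hfg
  have hdeg : ∀ x : s, ∃ k, x.1 ∈ ℳ k ∧ k ≤ β := fun x => by
    have := hs x.2
    simp only [Set.mem_iUnion] at this
    obtain ⟨k, hk, hx⟩ := this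
    exact ⟨k, hx, hk⟩
  choose b hb using hdeg
  refine ⟨s.card, fun i => (s.equivFin.symm i).1, fun i => b (s.equivFin.symm i),
    fun i => hb _, ?_⟩
  rw [← h, hspan]
  congr 1
  ext x
  simp only [Set.mem_range, Finset.mem_coe]
  exact ⟨by rintro ⟨i, rfl⟩; exact (s.equivFin.symm i).2,
    fun hx => ⟨s.equivFin ⟨x, hx⟩, by simp⟩⟩

variable {𝒜 : ℤ → AddSubgroup R} [GradedRing 𝒜] {ℳ : ℤ → AddSubgroup M}
  [DirectSum.Decomposition ℳ] [SetLike.GradedSMul 𝒜 ℳ] {m : ℕ} {g : Fin m → M} {b : Fin m → ℤ}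

lemma linearCombination_proj (hg : ∀ i, g i ∈ ℳ (b i)) (k : ℤ) (a : Fin m → R) :
    Fintype.linearCombination R g (fun i => proj 𝒜 (k - b i) (a i)) =
      proj ℳ k (Fintype.linearCombination R g a) := by
  simp only [Fintype.linearCombination_apply, map_sum]
  exact Finset.sum_congr rfl fun i _ => (proj_smul_of_mem (hg i) k (a i)).symm

variable (𝒜) in
/-- The degree `k` part of a submodule of the graded free module with generators in degrees
`b i`. -/
def freeGrading (b : Fin m → ℤ) (K : Submodule R (Fin m → R)) (k : ℤ) : AddSubgroup K where
  carrier := {a | ∀ i, a.1 i ∈ 𝒜 (k - b i)}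
  zero_mem' _ := zero_mem _
  add_mem' ha ha' i := add_mem (ha i) (ha' i)
  neg_mem' ha i := neg_mem (ha i)

/-- The projections onto the graded pieces of a graded submodule of a graded free module. -/
def freeProj (K : Submodule R (Fin m → R))
    (hK : ∀ a ∈ K, ∀ k, (fun i => proj 𝒜 (k - b i) (a i)) ∈ K) (k : ℤ) : K →+ K where
  toFun a := ⟨fun i => proj 𝒜 (k - b i) (a.1 i), hK a a.2 k⟩
  map_zero' := by
    ext
    simp
  map_add' a a' := by
    ext
    simp

lemma freeProj_apply {K : Submodule R (Fin m → R)}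
    (hK : ∀ a ∈ K, ∀ k, (fun i => proj 𝒜 (k - b i) (a i)) ∈ K) (k : ℤ) (a : K) (i : Fin m) :
    (freeProj K hK k a).1 i = proj 𝒜 (k - b i) (a.1 i) := rfl

lemma homProj_freeProj {y : Fin n → R} {e : Fin n → ℤ} (hy : ∀ j, y j ∈ 𝒜 (e j))
    {K : Submodule R (Fin m → R)}
    (hK : ∀ a ∈ K, ∀ k, (fun i => proj 𝒜 (k - b i) (a i)) ∈ K) :
    HomProj y e (freeGrading 𝒜 b K) (freeProj K hK) where
  mem k x i := proj_mem _ _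
  eq k x hx := by
    ext i
    exact proj_of_mem (hx i)
  map_smul j k x := by
    ext i
    have := proj_add_smul (ℳ := 𝒜) (hy j) (k - b i) (x.1 i)
    rw [freeProj_apply, show k + e j - b i = k - b i + e j by ring]
    exact this

end FreeCover

theorem statement9
    (𝒜 : ℤ → AddSubgroup R) [GradedRing 𝒜]
    (hNoeth : IsNoetherianRing R)
    (hnonneg : ∀ i : ℤ, i < 0 → 𝒜 i = ⊥)
    -- `R₀` is an Artinian local ring
    (hloc : IsLocalRing ↥(𝒜 0)) (hart : IsArtinianRing ↥(𝒜 0))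
    -- `d = dim R` and `R` is Cohen–Macaulay
    (d : ℕ) (hdim : ringKrullDim R = (d : WithBot (WithTop ℕ)))
    (hCM : depthGE (maxHomIdeal 𝒜) R d)
    -- `y₁,…,yₙ` is a minimal homogeneous generating set of `𝔪`,
    -- with degrees `e₁ ≥ e₂ ≥ ⋯ ≥ eₙ`
    (n : ℕ) (y : Fin n → R) (e : Fin n → ℤ)
    (hyhomog : ∀ j, y j ∈ 𝒜 (e j))
    (hygen : Ideal.span (Set.range y) = maxHomIdeal 𝒜)
    (hymin : ∀ j, y j ∉ Ideal.span (y '' {k | k ≠ j}))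
    (hsorted : ∀ j k : Fin n, j ≤ k → e k ≤ e j)
    -- `M` is a finitely generated graded `R`-module of depth zero
    (M : Type) [AddCommGroup M] [Module R M] [Module.Finite R M]
    (ℳ : ℤ → AddSubgroup M) [DirectSum.Decomposition ℳ] [SetLike.GradedSMul 𝒜 ℳ]
    (hdepth0 : Nontrivial M ∧ ¬ depthGE (maxHomIdeal 𝒜) M 1)
    -- `M / H⁰_𝔪(M)` is a maximal Cohen–Macaulay `R`-module
    (hMCM : depthGE (maxHomIdeal 𝒜) (M ⧸ torsionSubmodule (maxHomIdeal 𝒜) M) d) :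
    -- conclusion: `b₀(H⁰_𝔪(M)) ≤ b₀(M) + Θ_d + a(R)`
    ∀ β γ : ℤ, GenDegLE (R := R) ℳ β →
      (∀ ℓ : ℤ, γ < ℓ → KVanish y (fun j => 𝒜 j) e d ℓ) →
      SubGenDegLE (R := R) ℳ (torsionSubmodule (maxHomIdeal 𝒜) M)
        (β + (∑ j ∈ Finset.univ.filter (fun j : Fin n => (j : ℕ) < d), e j) + γ) := by
  intro β γ hβ hγ
  rw [← hygen] at hCM hMCM ⊢
  obtain ⟨m, g, b, hg, hspan⟩ := hβ.exists_generators
  set T := torsionSubmodule (Ideal.span (Set.range y)) M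
  have hTproj : ∀ x ∈ T, ∀ k, proj ℳ k x ∈ T := fun x hx k =>
    proj_mem_torsionSubmodule (𝒜 := 𝒜) hyhomog hx k
  refine subGenDegLE_of_mem_smul (𝒜 := 𝒜) hloc hnonneg (IsNoetherian.noetherian T) hTproj
    fun k hk x hxT hxk => ?_
  let φ := Fintype.linearCombination R g
  let π := T.mkQ ∘ₗ φ
  have hφ : Function.Surjective φ := by
    rw [← LinearMap.range_eq_top, Fintype.range_linearCombination, hspan]
  have hπ : Function.Surjective π := T.mkQ_surjective.comp hφ
  have hmem : ∀ a, a ∈ LinearMap.ker π ↔ φ a ∈ T := fun a => by simp [π]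
  have hK : ∀ a ∈ LinearMap.ker π, ∀ k, (fun i => proj 𝒜 (k - b i) (a i)) ∈ LinearMap.ker π := by
    intro a ha k
    rw [hmem] at ha ⊢
    exact (linearCombination_proj (𝒜 := 𝒜) (fun i => (hg i).1) k a).symm ▸ hTproj _ ha k
  have hinj := (LinearMap.ker π).injective_subtype
  have hex := LinearMap.exact_subtype_ker_map π
  have hR : ∀ p, p ≠ d → CohVanish y R p := fun p hp => cohVanish_of_depthGE hdim hCM hp
  have hQ : ∀ p, p < d → CohVanish y (M ⧸ T) p := by
    intro p hp
    obtain hs | ⟨rs, hlen, hrs, hreg⟩ := hMCM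
    · exact CohVanish.of_subsingleton p
    · exact CohVanish.of_isWeaklyRegular hrs hreg.toIsWeaklyRegular (hlen ▸ hp)
  have hKV : ∀ p, p ≠ d → CohVanish y (LinearMap.ker π) p := by
    intro p hp
    rcases lt_or_gt_of_ne hp with hp' | hp'
    · exact CohVanish.of_injective hinj hπ hex (fun q hq => hQ q (by omega)) (hR p hp).pi
    · exact CohVanish.of_finite (fun q hq => hR q hq.ne') hp'
  obtain ⟨a, rfl⟩ := hφ x
  let a' : LinearMap.ker π := freeProj _ hK k ⟨a, (hmem a).mpr hxT⟩
  have ha' : φ a'.1 = φ a :=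
    (linearCombination_proj (𝒜 := 𝒜) (fun i => (hg i).1) k a).trans (proj_of_mem hxk)
  have hd : ∀ ℓ, β + γ < ℓ → ∀ (t : ℕ) (f : Finset (Fin n) → LinearMap.ker π),
      koszul y _ t f = 0 → restr R _ d f = f →
      IsHomog (freeGrading 𝒜 b (LinearMap.ker π)) e t ℓ f → EvBoundary y t f := by
    intro ℓ hℓ t f hf hfd hfh
    refine EvBoundary.of_comp_injective hinj hπ hex (fun q hq => hQ q (by omega)) hfd
      (EvBoundary.of_pi fun i => ?_)
    let ψ := (LinearMap.proj i : (Fin m → R) →ₗ[R] R) ∘ₗ (LinearMap.ker π).subtype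
    refine (hγ (ℓ - b i) (by linarith [(hg i).2])).evBoundary (f := ψ ∘ f) ?_ ?_ fun S => ?_
    · rw [koszul_comp, hf]
      ext
      simp
    · rw [restr_comp, hfd]
    · have h : (f S).1 i ∈ 𝒜 (ℓ + (t : ℤ) * ∑ j ∈ S, e j - b i) := hfh S i
      rwa [add_sub_right_comm] at h
  obtain ⟨c, hc⟩ := exists_eq_sum_smul (homProj_freeProj hyhomog hK) hKV hd
    (fun S hS => by linarith [sum_le_sum_filter_lt hsorted hS])
    ((homProj_freeProj (y := y) hyhomog hK).mem k ⟨a, (hmem a).mpr hxT⟩)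
  have hφc : φ a = ∑ j, y j • φ (c j).1 := by
    rw [← ha', show a' = _ from hc]
    simp
  rw [hφc]
  refine sum_mem fun j _ => Submodule.smul_mem_smul ?_ ((hmem _).mp (c j).2)
  rw [← hygen]
  exact Ideal.subset_span (Set.mem_range_self j)

end Paper
end
end

section
/- Let k be a field, H a numerical semigroup minimally generated by positive integers h_1 < h_2 < ⋯ < h_ℓ, P the polynomial ring k[x_1,…,x_ℓ], and 𝔭 ⊆ P the prime ideal defining the monomial curve {(τ^{h_1},…,τ^{h_ℓ}) : τ ∈ k} ⊆ 𝔸^ℓ_k, i.e., the kernel of the k-algebra homomorphism P → k[t] sending x_i to t^{h_i}. Then b_0(𝔭^{(2)}) ≤ max{ b_0(𝔭) + h_ℓ + F(H), 2·b_0(𝔭) }, where h_ℓ is the maximal generator of H and F(H) is the Frobenius number of H. -/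
/-!
Statement 11 (Corollary `monomialCurve` of the paper).

`k` is a field, `H` the numerical semigroup minimally generated by positive integers
`h₁ < h₂ < ⋯ < h_ℓ`, `P = k[x₁,…,x_ℓ]` graded with `deg xᵢ = hᵢ`, and `𝔭 ⊆ P` the
prime ideal defining the monomial curve, i.e. the kernel of the `k`-algebra map
`P → k[t]`, `xᵢ ↦ t^{hᵢ}`.  Then

`b₀(𝔭⁽²⁾) ≤ max{ b₀(𝔭) + h_ℓ + F(H), 2 b₀(𝔭) }`,

where `F(H)` is the Frobenius number of `H` (the largest integer not in `H`), and
`𝔭⁽²⁾ = 𝔭² P_𝔭 ∩ P` is the second symbolic power.  The generator-degree bound is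
stated in universally quantified form using the weighted-homogeneous grading on `P`.
-/

noncomputable section
namespace Paper

variable {k : Type} [Field k]

/-- The multiplicative set `W`: the complement of the union of the associated primes. -/
def assPrimeComplement {P : Type} [CommRing P] (I : Ideal P) : Submonoid P where
  carrier := { w : P | ∀ Q ∈ associatedPrimes P (P ⧸ I), w ∉ Q }
  one_mem' := by
    intro Q hQ h1
    exact hQ.1.ne_top (Ideal.eq_top_iff_one Q |>.mpr h1)
  mul_mem' := by
    intro a b ha hb Q hQ hab
    rcases hQ.1.mem_or_mem hab with h | h
    · exact ha Q hQ h
    · exact hb Q hQ h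

/-- The `t`-th symbolic power `I⁽ᵗ⁾ = Iᵗ P_W ∩ P`. -/
def symbolicPower {P : Type} [CommRing P] (I : Ideal P) (t : ℕ) : Ideal P :=
  Ideal.comap (algebraMap P (Localization (assPrimeComplement I)))
    (Ideal.map (algebraMap P (Localization (assPrimeComplement I))) (I ^ t))

/-- The ideal `J` of the weighted-graded polynomial ring `k[x₁,…,x_ℓ]`
(`deg xᵢ = w i`) is generated in (weighted) degrees at most `b`. -/
def IdealGenDegLE {ℓv : ℕ} (w : Fin ℓv → ℕ) (J : Ideal (MvPolynomial (Fin ℓv) k))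
    (b : ℤ) : Prop :=
  J ≤ Ideal.span ((J : Set (MvPolynomial (Fin ℓv) k)) ∩
    ⋃ (j : ℕ) (_ : (j : ℤ) ≤ b),
      (MvPolynomial.weightedHomogeneousSubmodule k w j : Set (MvPolynomial (Fin ℓv) k)))

section Homogenization

open Polynomial (C X)

variable {n : ℕ}

/-- The map `xᵢ ↦ xᵢ T^{wᵢ}`, whose `T^d`-coefficient extracts the weight `d` component. -/
def homogenize (w : Fin n → ℕ) :
    MvPolynomial (Fin n) k →ₐ[k] Polynomial (MvPolynomial (Fin n) k) :=
  MvPolynomial.aeval fun i => C (MvPolynomial.X i) * X ^ w i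

theorem homogenize_monomial (w : Fin n → ℕ) (ν : Fin n →₀ ℕ) (r : k) :
    homogenize w (MvPolynomial.monomial ν r) =
      C (MvPolynomial.monomial ν r) * X ^ Finsupp.weight w ν := by
  rw [homogenize, MvPolynomial.aeval_monomial, MvPolynomial.monomial_eq, Finsupp.weight_apply,
    Polynomial.algebraMap_apply, MvPolynomial.algebraMap_eq]
  simp only [Finsupp.prod, Finsupp.sum, mul_pow, Finset.prod_mul_distrib, map_mul, map_prod,
    map_pow, ← pow_mul, Finset.prod_pow_eq_pow_sum, smul_eq_mul]
  rw [mul_assoc]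
  congr 2
  exact congrArg (fun e => (X : Polynomial (MvPolynomial (Fin n) k)) ^ e) (Finset.sum_congr rfl fun i _ => mul_comm _ _)

theorem homogenize_of_isWeightedHomogeneous {w : Fin n → ℕ} {d : ℕ}
    {g : MvPolynomial (Fin n) k} (hg : MvPolynomial.IsWeightedHomogeneous w g d) :
    homogenize w g = C g * X ^ d := by
  conv_lhs => rw [g.as_sum]
  conv_rhs => rw [g.as_sum]
  rw [map_sum, map_sum, Finset.sum_mul]
  refine Finset.sum_congr rfl fun ν hν => ?_
  rw [homogenize_monomial, hg (MvPolynomial.mem_support_iff.1 hν)]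

theorem isWeightedHomogeneous_coeff_homogenize (w : Fin n → ℕ) (f : MvPolynomial (Fin n) k)
    (d : ℕ) : MvPolynomial.IsWeightedHomogeneous w ((homogenize w f).coeff d) d := by
  induction f using MvPolynomial.induction_on' with
  | monomial ν r =>
    rw [homogenize_monomial, Polynomial.coeff_C_mul_X_pow]
    split_ifs with hd
    · exact MvPolynomial.isWeightedHomogeneous_monomial w ν r hd.symm
    · exact MvPolynomial.isWeightedHomogeneous_zero k w d
  | add p q hp hq =>
    rw [map_add, Polynomial.coeff_add]
    exact hp.add hq

theorem eval_one_homogenize (w : Fin n → ℕ) (f : MvPolynomial (Fin n) k) :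
    (homogenize w f).eval 1 = f := by
  induction f using MvPolynomial.induction_on' with
  | monomial ν r => simp [homogenize_monomial]
  | add p q hp hq => rw [map_add, Polynomial.eval_add, hp, hq]

theorem mem_of_forall_coeff_homogenize_mem {w : Fin n → ℕ} {I : Ideal (MvPolynomial (Fin n) k)}
    {f : MvPolynomial (Fin n) k} (hf : ∀ d, (homogenize w f).coeff d ∈ I) : f ∈ I := by
  rw [← eval_one_homogenize w f, Polynomial.eval_eq_sum]
  exact Ideal.sum_mem _ fun d _ => I.mul_mem_right _ (hf d)

theorem exists_aeval_eq_of_isWeightedHomogeneous {w : Fin n → ℕ} {d : ℕ}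
    {g : MvPolynomial (Fin n) k} (hg : MvPolynomial.IsWeightedHomogeneous w g d) :
    ∃ c : k, MvPolynomial.aeval (fun i => (X : Polynomial k) ^ w i) g = C c * X ^ d := by
  refine ⟨∑ ν ∈ g.support, g.coeff ν, ?_⟩
  conv_lhs => rw [g.as_sum]
  rw [map_sum, map_sum, Finset.sum_mul]
  refine Finset.sum_congr rfl fun ν hν => ?_
  rw [MvPolynomial.aeval_monomial, ← hg (MvPolynomial.mem_support_iff.1 hν), Finsupp.weight_apply]
  simp only [Finsupp.prod, Finsupp.sum, ← pow_mul, Finset.prod_pow_eq_pow_sum, smul_eq_mul]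
  exact congrArg (fun e => C (g.coeff ν) * X ^ e) (Finset.sum_congr rfl fun i _ => mul_comm _ _)

theorem exists_aeval_eq_X_pow (w : Fin n → ℕ) {m : ℕ}
    (hm : m ∈ AddSubmonoid.closure (Set.range w)) :
    ∃ μ : MvPolynomial (Fin n) k, MvPolynomial.aeval (fun i => (X : Polynomial k) ^ w i) μ = X ^ m := by
  induction hm using AddSubmonoid.closure_induction with
  | mem x hx =>
    obtain ⟨i, rfl⟩ := hx
    exact ⟨MvPolynomial.X i, by simp⟩
  | zero => exact ⟨1, by simp⟩
  | add x y _ _ hx hy =>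
    obtain ⟨μ, hμ⟩ := hx
    obtain ⟨ν, hν⟩ := hy
    exact ⟨μ * ν, by rw [map_mul, hμ, hν, pow_add]⟩

end Homogenization

section SymbolicPower

theorem mem_assPrimeComplement_iff {P : Type} [CommRing P] [IsNoetherianRing P] {I : Ideal P}
    [hI : I.IsPrime] {s : P} : s ∈ assPrimeComplement I ↔ s ∉ I := by
  change (∀ Q ∈ associatedPrimes P (P ⧸ I), s ∉ Q) ↔ s ∉ I
  rw [associatedPrimes.eq_singleton_of_isPrimary hI.isPrimary, hI.radical]
  simp

theorem mem_symbolicPower_iff {P : Type} [CommRing P] [IsNoetherianRing P] {I : Ideal P}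
    [I.IsPrime] {t : ℕ} {f : P} : f ∈ symbolicPower I t ↔ ∃ s ∉ I, s * f ∈ I ^ t := by
  rw [symbolicPower, Ideal.mem_comap,
    IsLocalization.algebraMap_mem_map_algebraMap_iff (assPrimeComplement I)]
  simp only [mem_assPrimeComplement_iff]

theorem pow_le_symbolicPower {P : Type} [CommRing P] (I : Ideal P) (t : ℕ) :
    I ^ t ≤ symbolicPower I t :=
  Ideal.le_comap_map

theorem symbolicPower_le {P : Type} [CommRing P] [IsNoetherianRing P] {I : Ideal P}
    [hI : I.IsPrime] {t : ℕ} (ht : t ≠ 0) : symbolicPower I t ≤ I := by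
  intro f hf
  obtain ⟨s, hs, hsf⟩ := mem_symbolicPower_iff.1 hf
  exact (hI.mem_or_mem (Ideal.pow_le_self ht hsf)).resolve_left hs

theorem mem_symbolicPower_of_mul_mem {P : Type} [CommRing P] [IsNoetherianRing P] {I : Ideal P}
    [hI : I.IsPrime] {t : ℕ} {s f : P} (hs : s ∉ I) (h : s * f ∈ symbolicPower I t) :
    f ∈ symbolicPower I t := by
  obtain ⟨u, hu, huf⟩ := mem_symbolicPower_iff.1 h
  refine mem_symbolicPower_iff.2 ⟨u * s, fun hus => ?_, by rwa [mul_assoc]⟩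
  exact (hI.mem_or_mem hus).elim hu hs

end SymbolicPower

section Generation

open Polynomial (C X)

variable {n : ℕ} {w : Fin n → ℕ} {I : Ideal (MvPolynomial (Fin n) k)}

theorem IdealGenDegLE.induction {β : ℤ} (hI : IdealGenDegLE w I β)
    {motive : MvPolynomial (Fin n) k → Prop}
    (zero : motive 0) (add : ∀ f g, motive f → motive g → motive (f + g))
    (mul : ∀ (a g : MvPolynomial (Fin n) k) (e : ℕ), g ∈ I → (e : ℤ) ≤ β →
      MvPolynomial.IsWeightedHomogeneous w g e → motive (a * g))
    {f : MvPolynomial (Fin n) k} (hf : f ∈ I) : motive f := by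
  refine Submodule.span_induction
    (p := fun x _ => ∀ a, motive (a * x)) ?_ ?_ ?_ ?_ (hI hf) 1 |> fun h => by simpa using h
  · rintro g ⟨hgI, hg⟩ a
    simp only [Set.mem_iUnion] at hg
    obtain ⟨e, he, hg⟩ := hg
    exact mul a g e hgI he hg
  · intro a
    rwa [mul_zero]
  · intro x y _ _ hx hy a
    rw [mul_add]
    exact add _ _ (hx a) (hy a)
  · intro b x _ hx a
    rw [smul_eq_mul, ← mul_assoc]
    exact hx _

/-- The square of an ideal generated in degrees at most `β` is generated by the homogeneous
elements of degree at most `2 * β` that it contains. -/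
theorem IdealGenDegLE.sq {β : ℤ} (hI : IdealGenDegLE w I β) : IdealGenDegLE w (I ^ 2) (2 * β) := by
  rw [IdealGenDegLE, pow_two, Ideal.mul_le]
  intro f hf g hg
  refine hI.induction (motive := fun f => f * g ∈ _) ?_ ?_ ?_ hf
  · rw [zero_mul]
    exact zero_mem _
  · intro f₁ f₂ h₁ h₂
    rw [add_mul]
    exact add_mem h₁ h₂
  intro a f' d hf' hd hfd
  refine hI.induction (motive := fun g => a * f' * g ∈ _) ?_ ?_ ?_ hg
  · rw [mul_zero]
    exact zero_mem _
  · intro f₁ f₂ h₁ h₂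
    rw [mul_add]
    exact add_mem h₁ h₂
  intro b g' e hg' he hge
  rw [mul_mul_mul_comm]
  refine Ideal.mul_mem_left _ _ (Ideal.subset_span ⟨Ideal.mul_mem_mul hf' hg', ?_⟩)
  simp only [Set.mem_iUnion]
  exact ⟨d + e, by push_cast; linarith, hfd.mul hge⟩

theorem IdealGenDegLE.homogenize_mem_map {β : ℤ} (hI : IdealGenDegLE w I β)
    {f : MvPolynomial (Fin n) k} (hf : f ∈ I) : homogenize w f ∈ I.map C := by
  refine hI.induction (motive := fun f => homogenize w f ∈ I.map C) ?_ ?_ ?_ hf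
  · rw [map_zero]
    exact zero_mem _
  · intro f g hf hg
    rw [map_add]
    exact add_mem hf hg
  · intro a g e hg _ hge
    rw [map_mul, homogenize_of_isWeightedHomogeneous hge]
    exact Ideal.mul_mem_left _ _ (Ideal.mul_mem_right _ _ (Ideal.mem_map_of_mem _ hg))

/-- Symbolic powers of a prime whose ordinary power is homogeneous are homogeneous. -/
theorem coeff_homogenize_mem_symbolicPower [I.IsPrime] {t : ℕ} {β : ℤ}
    (hI : IdealGenDegLE w (I ^ t) β) {f : MvPolynomial (Fin n) k} (hf : f ∈ symbolicPower I t)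
    (d : ℕ) : (homogenize w f).coeff d ∈ symbolicPower I t := by
  obtain ⟨s, hs, hsf⟩ := mem_symbolicPower_iff.1 hf
  let π := Ideal.Quotient.mk (symbolicPower I t)
  have hmul : (homogenize w f).map π * (homogenize w s).map π = 0 := by
    rw [← Polynomial.map_mul, ← map_mul, mul_comm f]
    ext e : 1
    rw [Polynomial.coeff_map, Polynomial.coeff_zero]
    exact Ideal.Quotient.eq_zero_iff_mem.2
      (pow_le_symbolicPower I t (Ideal.mem_map_C_iff.1 (hI.homogenize_mem_map hsf) e))
  have hreg : (homogenize w s).map π ∈ nonZeroDivisors _ := by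
    by_contra hdiv
    obtain ⟨a, ha, has⟩ := Polynomial.notMem_nonZeroDivisors_iff.1 hdiv
    obtain ⟨a, rfl⟩ := Ideal.Quotient.mk_surjective a
    refine hs (mem_of_forall_coeff_homogenize_mem (w := w) fun e => ?_)
    by_contra hse
    refine ha (Ideal.Quotient.eq_zero_iff_mem.2 (mem_symbolicPower_of_mul_mem hse ?_))
    rw [← Ideal.Quotient.eq_zero_iff_mem, mul_comm, map_mul]
    simpa using congrArg (fun q => Polynomial.coeff q e) has
  have hzero := (mul_right_mem_nonZeroDivisors_eq_zero_iff hreg).1 hmul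
  rw [← Ideal.Quotient.eq_zero_iff_mem]
  simpa using congrArg (fun q => Polynomial.coeff q d) hzero

/-- In high degrees, every element of the ideal of a monomial curve is, modulo the square of the
ideal, a multiple of a given variable by an element of the ideal. -/
theorem exists_coeff_homogenize_sub_mem_sq {F : ℤ} (hFlb : -1 ≤ F)
    (hFin : ∀ m : ℕ, F < (m : ℤ) → m ∈ AddSubmonoid.closure (Set.range w))
    (hI : I = RingHom.ker (MvPolynomial.aeval
      (fun i : Fin n => (X : Polynomial k) ^ (w i))).toRingHom)
    {β : ℤ} (hβ : IdealGenDegLE w I β) (i : Fin n) {d : ℕ} (hd : β + w i + F < d)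
    {f : MvPolynomial (Fin n) k} (hf : f ∈ I) :
    ∃ q ∈ I, (homogenize w f).coeff d - MvPolynomial.X i * q ∈ I ^ 2 := by
  refine hβ.induction (motive := fun f => ∃ q ∈ I,
    (homogenize w f).coeff d - MvPolynomial.X i * q ∈ I ^ 2) ?_ ?_ ?_ hf
  · exact ⟨0, zero_mem _, by simp⟩
  · rintro f g ⟨q, hq, hfq⟩ ⟨r, hr, hgr⟩
    refine ⟨q + r, add_mem hq hr, ?_⟩
    convert add_mem hfq hgr using 1
    rw [map_add, Polynomial.coeff_add]
    ring
  intro a g e hg he hge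
  obtain ⟨m, rfl⟩ : ∃ m, d = m + w i + e := ⟨d - e - w i, by omega⟩
  obtain ⟨μ, hμ⟩ := exists_aeval_eq_X_pow (k := k) w
    (hFin m (by push_cast at hd; linarith))
  obtain ⟨c, hc⟩ := exists_aeval_eq_of_isWeightedHomogeneous
    (isWeightedHomogeneous_coeff_homogenize w a (m + w i))
  refine ⟨MvPolynomial.C c * μ * g, I.mul_mem_left _ hg, ?_⟩
  have hker : (homogenize w a).coeff (m + w i) -
      MvPolynomial.X i * (MvPolynomial.C c * μ) ∈ I := by
    subst hI
    rw [RingHom.mem_ker]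
    change MvPolynomial.aeval _ _ = 0
    rw [map_sub, hc, map_mul, map_mul, hμ, MvPolynomial.aeval_X, MvPolynomial.aeval_C,
      ← Polynomial.C_eq_algebraMap]
    ring
  rw [map_mul, homogenize_of_isWeightedHomogeneous hge, ← mul_assoc, Polynomial.coeff_mul_X_pow,
    Polynomial.coeff_mul_C, ← mul_assoc, ← sub_mul, pow_two]
  exact Ideal.mul_mem_mul hker hg

end Generation

theorem statement11
    (ℓv : ℕ) (hℓ : 0 < ℓv)
    -- the minimal generators `h₁ < ⋯ < h_ℓ` of the numerical semigroup `H`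
    (h : Fin ℓv → ℕ) (hpos : ∀ i, 0 < h i) (hmono : StrictMono h)
    (hminimal : ∀ i, h i ∉ AddSubmonoid.closure (h '' {j | j ≠ i}))
    -- `F` is the Frobenius number of `H = ⟨h₁,…,h_ℓ⟩`
    (F : ℤ) (hFlb : -1 ≤ F)
    (hFout : ∀ m : ℕ, (m : ℤ) = F → m ∉ AddSubmonoid.closure (Set.range h))
    (hFin : ∀ m : ℕ, F < (m : ℤ) → m ∈ AddSubmonoid.closure (Set.range h))
    -- `𝔭` is the defining (prime) ideal of the monomial curve: the kernel of
    -- `k[x₁,…,x_ℓ] → k[t]`, `xᵢ ↦ t^{hᵢ}`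
    (𝔭 : Ideal (MvPolynomial (Fin ℓv) k))
    (h𝔭 : 𝔭 = RingHom.ker (MvPolynomial.aeval
      (fun i : Fin ℓv => (Polynomial.X : Polynomial k) ^ (h i))).toRingHom) :
    -- conclusion:
    -- `b₀(𝔭⁽²⁾) ≤ max{ b₀(𝔭) + (max generator of H) + (Frobenius number), 2 b₀(𝔭) }`
    ∀ β : ℤ, IdealGenDegLE (k := k) h 𝔭 β →
      IdealGenDegLE (k := k) h (symbolicPower 𝔭 2)
        (max (β + (h ⟨ℓv - 1, by omega⟩ : ℤ) + F) (2 * β)) := by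
  intro β hβ
  set i : Fin ℓv := ⟨ℓv - 1, by omega⟩
  have hprime : 𝔭.IsPrime := h𝔭 ▸ RingHom.ker_isPrime _
  have hX : (MvPolynomial.X i : MvPolynomial (Fin ℓv) k) ∉ 𝔭 := by
    rw [h𝔭, RingHom.mem_ker]
    change MvPolynomial.aeval _ _ ≠ 0
    rw [MvPolynomial.aeval_X]
    exact pow_ne_zero _ Polynomial.X_ne_zero
  let J := symbolicPower 𝔭 2
  set b := max (β + (h i : ℤ) + F) (2 * β)
  let K := Ideal.span ((J : Set (MvPolynomial (Fin ℓv) k)) ∩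
    ⋃ (j : ℕ) (_ : (j : ℤ) ≤ b),
      (MvPolynomial.weightedHomogeneousSubmodule k h j : Set (MvPolynomial (Fin ℓv) k)))
  have hsq : 𝔭 ^ 2 ≤ K := hβ.sq.trans <| Ideal.span_mono <|
    Set.inter_subset_inter (pow_le_symbolicPower 𝔭 2) <|
      Set.iUnion_mono fun _ => Set.iUnion_mono' fun hj => ⟨hj.trans (le_max_right _ _), subset_rfl⟩
  suffices H : ∀ d : ℕ, ∀ f ∈ J, (homogenize h f).coeff d ∈ K from
    fun f hf => mem_of_forall_coeff_homogenize_mem fun d => H d f hf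
  intro d
  induction d using Nat.strong_induction_on with | _ d ih => ?_
  intro f hf
  have hfd : (homogenize h f).coeff d ∈ J := coeff_homogenize_mem_symbolicPower hβ.sq hf d
  by_cases hd : (d : ℤ) ≤ b
  · refine Ideal.subset_span ⟨hfd, ?_⟩
    simp only [Set.mem_iUnion]
    exact ⟨d, hd, isWeightedHomogeneous_coeff_homogenize h f d⟩
  obtain ⟨q, -, hq⟩ := exists_coeff_homogenize_sub_mem_sq hFlb hFin h𝔭 hβ i
    ((le_max_left _ _).trans_lt (not_le.1 hd)) (symbolicPower_le two_ne_zero hf)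
  have hqJ : q ∈ J := by
    refine mem_symbolicPower_of_mul_mem hX ?_
    simpa using sub_mem hfd (pow_le_symbolicPower 𝔭 2 hq)
  have hcoeff := hsq (Ideal.mem_map_C_iff.1 (hβ.sq.homogenize_mem_map hq) d)
  rw [map_sub, Polynomial.coeff_sub, map_mul,
    homogenize_of_isWeightedHomogeneous (isWeightedHomogeneous_coeff_homogenize h f d),
    homogenize_of_isWeightedHomogeneous (MvPolynomial.isWeightedHomogeneous_X k h i),
    Polynomial.coeff_C_mul_X_pow, if_pos rfl, mul_right_comm, Polynomial.coeff_mul_X_pow',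
    Polynomial.coeff_C_mul] at hcoeff
  refine (Submodule.sub_mem_iff_left K ?_).1 hcoeff
  split_ifs with hdi
  · exact Ideal.mul_mem_left _ _ (ih (d - h i) (by have := hpos i; omega) q hqJ)
  · exact zero_mem _

end Paper
end
end
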